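/- arXiv:2305.00746 — 4 statements merged into one kernel-verified Lean document; each statement's English description precedes it below -/
import Mathlib

section
/- Let n ≥ 1 and 0 < α < n. Let 1 ≤ s < ∞ and 1 < r < ∞ satisfy 1/r = 1/s + α/n. Then there exists a constant C = C(n, s, α) > 0 such that for every measurable g : ℝⁿ → ℂ, ‖I_α * g‖_{L^s(ℝⁿ)} ≤ C ‖g‖_{L^r(ℝⁿ)}. -/
open MeasureTheory

open Set Metric Module

theorem preimage_inv_smul_ball {E : Type*} [SeminormedAddCommGroup E] [NormedSpace ℝ E] {ρ : ℝ}
    (hρ : 0 < ρ) : (fun x : E => ρ⁻¹ • x) ⁻¹' ball 0 1 = ball 0 ρ := by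
  ext x
  simp [norm_smul, abs_of_pos hρ, inv_mul_lt_iff₀ hρ]

section RieszKernel

variable {E : Type*} [NormedAddCommGroup E] [NormedSpace ℝ E] [FiniteDimensional ℝ E]
  [MeasurableSpace E] [BorelSpace E] {μ : Measure E} [μ.IsAddHaarMeasure]

/-- Change of variables by a dilation, for the lower Lebesgue integral. -/
theorem lintegral_comp_smul_of_pos (f : E → ENNReal) (hf : Measurable f) {ρ : ℝ} (hρ : 0 < ρ) :
    ∫⁻ x, f x ∂μ = ENNReal.ofReal (ρ ^ (finrank ℝ E : ℝ)) * ∫⁻ x, f (ρ • x) ∂μ := by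
  have h1 : ∫⁻ x, f (ρ • x) ∂μ = ∫⁻ x, f x ∂(Measure.map (ρ • ·) μ) :=
    (lintegral_map hf (measurable_const_smul ρ)).symm
  rw [h1, Measure.map_addHaar_smul μ hρ.ne', lintegral_smul_measure, smul_eq_mul, ← mul_assoc,
    ← ENNReal.ofReal_mul (by positivity), abs_of_pos (by positivity), Real.rpow_natCast,
    mul_inv_cancel₀ (by positivity), ENNReal.ofReal_one, one_mul]

/-- Integrals of powers of the norm over dilates of a set are homogeneous. -/
theorem setLIntegral_norm_rpow_smul (γ : ℝ) {S : Set E} (hS : MeasurableSet S) {ρ : ℝ}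
    (hρ : 0 < ρ) :
    ∫⁻ x in (ρ⁻¹ • ·) ⁻¹' S, ENNReal.ofReal (‖x‖ ^ γ) ∂μ =
      ENNReal.ofReal (ρ ^ (γ + finrank ℝ E)) * ∫⁻ x in S, ENNReal.ofReal (‖x‖ ^ γ) ∂μ := by
  have hS' : MeasurableSet ((fun x : E => ρ⁻¹ • x) ⁻¹' S) := measurable_const_smul _ hS
  rw [← lintegral_indicator hS', ← lintegral_indicator hS,
    lintegral_comp_smul_of_pos _ (Measurable.indicator (by fun_prop) hS') hρ,
    Real.rpow_add hρ, mul_comm (ρ ^ γ), ENNReal.ofReal_mul (by positivity), mul_assoc,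
    ← lintegral_const_mul _ (Measurable.indicator (by fun_prop) hS)]
  congr 2 with x
  by_cases hx : x ∈ S
  · simp [indicator, hx, smul_smul, hρ.ne', norm_smul, abs_of_pos hρ,
      Real.mul_rpow hρ.le (norm_nonneg x), ENNReal.ofReal_mul (Real.rpow_nonneg hρ.le γ)]
  · simp [indicator, hx, smul_smul, hρ.ne']

theorem exists_setLIntegral_ball_norm_rpow_le (hE : 1 ≤ finrank ℝ E) {γ : ℝ}
    (hγ : -(finrank ℝ E : ℝ) < γ) :
    ∃ A : ℝ, 0 < A ∧ ∀ ρ : ℝ, 0 < ρ →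
      ∫⁻ x in ball (0 : E) ρ, ENNReal.ofReal (‖x‖ ^ γ) ∂μ ≤
        ENNReal.ofReal (A * ρ ^ (γ + finrank ℝ E)) := by
  have hfin : ∫⁻ x in ball (0 : E) 1, ENNReal.ofReal (‖x‖ ^ γ) ∂μ < ⊤ := by
    have h := integrableOn_ball_of_norm_le_rpow (μ := μ) (r := 1) (C := 1) (α := -γ) hE
      (f := fun x : E => ‖x‖ ^ γ) (by linarith)
      (by
        refine Filter.Eventually.of_forall fun x => ?_
        simp [abs_of_nonneg (Real.rpow_nonneg (norm_nonneg x) γ)])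
      (measurable_norm.pow_const γ).aestronglyMeasurable
    exact h.lintegral_lt_top
  refine ⟨(∫⁻ x in ball (0 : E) 1, ENNReal.ofReal (‖x‖ ^ γ) ∂μ).toReal + 1,
    add_pos_of_nonneg_of_pos ENNReal.toReal_nonneg one_pos, fun ρ hρ => ?_⟩
  rw [← preimage_inv_smul_ball hρ, setLIntegral_norm_rpow_smul γ measurableSet_ball hρ, mul_comm,
    ENNReal.ofReal_mul (by positivity), ENNReal.ofReal_add ENNReal.toReal_nonneg one_pos.le,
    ENNReal.ofReal_toReal hfin.ne]
  gcongr
  exact le_self_add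

theorem exists_setLIntegral_compl_ball_norm_rpow_le {γ : ℝ} (hγ : γ < -(finrank ℝ E : ℝ)) :
    ∃ B : ℝ, 0 < B ∧ ∀ ρ : ℝ, 0 < ρ →
      ∫⁻ x in (ball (0 : E) ρ)ᶜ, ENNReal.ofReal (‖x‖ ^ γ) ∂μ ≤
        ENNReal.ofReal (B * ρ ^ (γ + finrank ℝ E)) := by
  have hfin : ∫⁻ x in (ball (0 : E) 1)ᶜ, ENNReal.ofReal (‖x‖ ^ γ) ∂μ < ⊤ := by
    have h := finite_integral_one_add_norm (μ := μ) (r := -γ) (E := E) (by linarith)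
    refine lt_of_le_of_lt ?_ (ENNReal.mul_lt_top (ENNReal.ofReal_lt_top (r := 2 ^ (-γ))) h)
    rw [← lintegral_const_mul _ (by fun_prop)]
    refine le_trans (setLIntegral_mono (by fun_prop) fun x hx => ?_) (setLIntegral_le_lintegral _ _)
    have hx1 : 1 ≤ ‖x‖ := by simpa using hx
    rw [← ENNReal.ofReal_mul (by positivity), neg_neg, Real.rpow_neg zero_le_two,
      inv_mul_eq_div, ← Real.div_rpow (by positivity) zero_le_two]
    exact ENNReal.ofReal_le_ofReal (Real.rpow_le_rpow_of_nonpos (by positivity) (by linarith)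
      (by have : (0 : ℝ) ≤ finrank ℝ E := by positivity
          linarith))
  refine ⟨(∫⁻ x in (ball (0 : E) 1)ᶜ, ENNReal.ofReal (‖x‖ ^ γ) ∂μ).toReal + 1,
    add_pos_of_nonneg_of_pos ENNReal.toReal_nonneg one_pos, fun ρ hρ => ?_⟩
  rw [← preimage_inv_smul_ball hρ, ← preimage_compl,
    setLIntegral_norm_rpow_smul γ measurableSet_ball.compl hρ, mul_comm,
    ENNReal.ofReal_mul (by positivity), ENNReal.ofReal_add ENNReal.toReal_nonneg one_pos.le,
    ENNReal.ofReal_toReal hfin.ne]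
  gcongr
  exact le_self_add

/-- Hölder's inequality for a convolution with a translate of `k`. -/
theorem lintegral_sub_mul_le_Lp_mul_Lq {p q : ℝ} (hpq : p.HolderConjugate q) {k G : E → ENNReal}
    (hk : Measurable k) (hG : Measurable G) (x : E) :
    ∫⁻ y, k (x - y) * G y ∂μ ≤ (∫⁻ y, k y ^ p ∂μ) ^ (1 / p) * (∫⁻ y, G y ^ q ∂μ) ^ (1 / q) := by
  refine (ENNReal.lintegral_mul_le_Lp_mul_Lq μ hpq (f := fun y => k (x - y))
    (by fun_prop) hG.aemeasurable).trans_eq ?_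
  rw [lintegral_sub_left_eq_self (fun y => k y ^ p)]

/-- Chebyshev's inequality for a convolution. -/
theorem mul_meas_ge_lintegral_sub_mul_le {k G : E → ENNReal}
    (hk : Measurable k) (hG : Measurable G) (ε : ENNReal) :
    ε * μ {x | ε ≤ ∫⁻ y, k (x - y) * G y ∂μ} ≤ (∫⁻ x, k x ∂μ) * ∫⁻ y, G y ∂μ := by
  have hm : Measurable fun z : E × E => k (z.1 - z.2) * G z.2 := by fun_prop
  refine (mul_meas_ge_le_lintegral hm.lintegral_prod_right' ε).trans_eq ?_
  rw [lintegral_lintegral_swap hm.aemeasurable, ← lintegral_const_mul _ hG]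
  congr 1 with y
  dsimp only
  rw [lintegral_mul_const _ (by fun_prop), lintegral_sub_right_eq_self k]

/-- Truncated weak-type estimate for the Riesz potential of a function in the unit ball of `L^r`:
only the large values of the function contribute to a superlevel set of its potential. -/
theorem exists_meas_lt_lintegral_norm_rpow_mul_le (hE : 1 ≤ finrank ℝ E) {α : ℝ} (hα0 : 0 < α)
    {s r : ℝ} (hs : 0 < s) (hr : 1 < r) (hsr : 1 / r = 1 / s + α / finrank ℝ E) :
    ∃ b M : ℝ, 0 < b ∧ 0 < M ∧ ∀ G : E → ENNReal, Measurable G → ∫⁻ y, G y ^ r ∂μ ≤ 1 →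
      ∀ t : ℝ, 0 < t →
        μ {x | ENNReal.ofReal t <
            ∫⁻ y, ENNReal.ofReal (‖x - y‖ ^ (α - (finrank ℝ E : ℝ))) * G y ∂μ} ≤
          ENNReal.ofReal (M * t ^ (-(s / r))) *
            ∫⁻ y in {y | ENNReal.ofReal (b * t ^ (s / r)) < G y}, G y ∂μ := by
  set d : ℝ := (finrank ℝ E : ℝ) with hd
  have hd0 : 0 < d := by rw [hd]; exact_mod_cast hE
  have hr0 : 0 < r := by linarith
  have hq : (r / (r - 1)).HolderConjugate r := by
    have := (Real.HolderConjugate.conjExponent hr).symm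
    simpa [Real.conjExponent] using this
  set q := r / (r - 1) with hq_def
  have hq0 : 0 < q := hq.pos
  have hqi : 1 / q = 1 - 1 / r := by
    have := hq.inv_add_inv_eq_one
    simp only [one_div]; linarith
  have hexp : (α - d) + d * (1 / q) = -(d / s) := by
    rw [hqi, hsr]; field_simp; ring
  have hexp' : ((α - d) * q + d) * (1 / q) = -(d / s) := by
    rw [← hexp]; field_simp
  have hneg : (α - d) * q < -d := by
    have h1 : ((α - d) * q + d) * (1 / q) < 0 := by rw [hexp']; simpa using div_pos hd0 hs
    have h2 : (0 : ℝ) < 1 / q := by positivity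
    nlinarith
  obtain ⟨A, hA, hAle⟩ := exists_setLIntegral_ball_norm_rpow_le (μ := μ) hE (γ := α - d)
    (by linarith)
  obtain ⟨B, hB, hBle⟩ := exists_setLIntegral_compl_ball_norm_rpow_le (μ := μ) hneg
  rw [← hd] at hAle hBle
  set a : ℝ := (3 * B ^ (1 / q)) ^ (s / d) with ha_def
  have ha : 0 < a := by positivity
  refine ⟨1 / (3 * A * a ^ α), 3 * A * a ^ α, by positivity, by positivity,
    fun G hG hG1 t ht => ?_⟩
  set γ : ℝ := 1 / (3 * A * a ^ α) * t ^ (s / r) with hγ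
  set ρ : ℝ := a * t ^ (-(s / d)) with hρ_def
  have hρ : 0 < ρ := by positivity
  have hsrd : s / r = 1 + s * α / d := by
    have : s / r = s * (1 / r) := by ring
    rw [this, hsr]; field_simp
  have hρα : ρ ^ α = a ^ α * t ^ (-(s * α / d)) := by
    rw [hρ_def, Real.mul_rpow ha.le (by positivity), ← Real.rpow_mul ht.le]
    congr 2; ring
  have hnear : A * ρ ^ α * γ = t / 3 := by
    have : t ^ (-(s * α / d)) * t ^ (s / r) = t := by
      rw [← Real.rpow_add ht, hsrd]; simp
    rw [hρα, hγ]
    calc _ = (t ^ (-(s * α / d)) * t ^ (s / r)) / 3 := by field_simp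
      _ = _ := by rw [this]
  have hfar : (B * ρ ^ ((α - d) * q + d)) ^ (1 / q) = t / 3 := by
    rw [Real.mul_rpow hB.le (by positivity), ← Real.rpow_mul hρ.le, hexp', hρ_def,
      Real.mul_rpow ha.le (by positivity), ← Real.rpow_mul ht.le, ha_def,
      ← Real.rpow_mul (by positivity)]
    have e1 : s / d * -(d / s) = -1 := by field_simp
    have e2 : -(s / d) * -(d / s) = 1 := by field_simp
    rw [e1, e2, Real.rpow_one, Real.rpow_neg_one]
    field_simp
  set K : E → ENNReal := fun x => ENNReal.ofReal (‖x‖ ^ (α - d)) with hK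
  have hKm : Measurable K := by fun_prop
  set K₁ : E → ENNReal := (ball 0 ρ).indicator K with hK₁
  have hK₁m : Measurable K₁ := hKm.indicator measurableSet_ball
  set K₂ : E → ENNReal := (ball 0 ρ)ᶜ.indicator K with hK₂
  have hK₂m : Measurable K₂ := hKm.indicator measurableSet_ball.compl
  set S : Set E := {y | ENNReal.ofReal γ < G y} with hS
  have hSm : MeasurableSet S := measurableSet_lt measurable_const hG
  have hK₁int : ∫⁻ x, K₁ x ∂μ ≤ ENNReal.ofReal (A * ρ ^ α) := by
    rw [hK₁, lintegral_indicator measurableSet_ball]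
    simpa using hAle ρ hρ
  have hK₂int : ∫⁻ x, K₂ x ^ q ∂μ ≤ ENNReal.ofReal (B * ρ ^ ((α - d) * q + d)) := by
    refine le_trans (le_of_eq ?_) (hBle ρ hρ)
    rw [← lintegral_indicator measurableSet_ball.compl]
    congr 1 with x
    by_cases hx : x ∈ (ball (0 : E) ρ)ᶜ
    · simp only [hK₂, hK, indicator_of_mem hx]
      rw [ENNReal.ofReal_rpow_of_nonneg (by positivity) hq0.le,
        ← Real.rpow_mul (norm_nonneg x)]
    · simp only [hK₂, indicator_of_notMem hx, ENNReal.zero_rpow_of_pos hq0]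
  have hsplit (x : E) : ∫⁻ y, K (x - y) * G y ∂μ ≤
      ∫⁻ y, K₁ (x - y) * S.indicator G y ∂μ + ENNReal.ofReal (t / 3) + ENNReal.ofReal (t / 3) := by
    calc _ ≤ ∫⁻ y, K₁ (x - y) * S.indicator G y + K₁ (x - y) * ENNReal.ofReal γ
          + K₂ (x - y) * G y ∂μ := by
          refine lintegral_mono fun y => ?_
          by_cases h : x - y ∈ ball (0 : E) ρ
          · simp only [hK₁, indicator_of_mem h, ← mul_add]
            refine le_trans ?_ le_self_add
            gcongr
            by_cases hy : y ∈ S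
            · simp [hy]
            · simpa [hy] using not_lt.mp hy
          · simp only [hK₂, indicator_of_mem (mem_compl h)]
            exact le_add_self
      _ = ∫⁻ y, K₁ (x - y) * S.indicator G y ∂μ + (∫⁻ y, K₁ y ∂μ) * ENNReal.ofReal γ
          + ∫⁻ y, K₂ (x - y) * G y ∂μ := by
          rw [lintegral_add_right _ (by fun_prop), lintegral_add_right _ (by fun_prop),
            lintegral_mul_const _ (by fun_prop), lintegral_sub_left_eq_self K₁]
      _ ≤ _ := by
          gcongr
          · rw [← hnear, ENNReal.ofReal_mul (p := A * ρ ^ α) (by positivity)]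
            exact mul_le_mul' hK₁int le_rfl
          · refine (lintegral_sub_mul_le_Lp_mul_Lq hq hK₂m hG x).trans ?_
            rw [← hfar, ← ENNReal.ofReal_rpow_of_nonneg (by positivity) (by positivity)]
            calc _ ≤ ENNReal.ofReal (B * ρ ^ ((α - d) * q + d)) ^ (1 / q) * 1 ^ (1 / r) := by
                  gcongr
              _ = _ := by simp
  have hsub : {x | ENNReal.ofReal t < ∫⁻ y, K (x - y) * G y ∂μ} ⊆
      {x | ENNReal.ofReal (t / 3) ≤ ∫⁻ y, K₁ (x - y) * S.indicator G y ∂μ} := by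
    intro x hx
    by_contra hcon
    have hlt : ∫⁻ y, K₁ (x - y) * S.indicator G y ∂μ ≤ ENNReal.ofReal (t / 3) :=
      (not_le.mp hcon).le
    refine absurd hx (not_lt.mpr ((hsplit x).trans ?_))
    refine (add_le_add_left (add_le_add_left hlt _) _).trans_eq ?_
    rw [← ENNReal.ofReal_add (by positivity) (by positivity),
      ← ENNReal.ofReal_add (by positivity) (by positivity)]
    congr 1; ring
  have hcheb := mul_meas_ge_lintegral_sub_mul_le (μ := μ) hK₁m (hG.indicator hSm)
    (ENNReal.ofReal (t / 3))
  rw [lintegral_indicator hSm] at hcheb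
  have hM : 3 * A * a ^ α * t ^ (-(s / r)) = (t / 3)⁻¹ * (A * ρ ^ α) := by
    rw [hρα, hsrd, neg_add, Real.rpow_add ht, Real.rpow_neg_one]
    field_simp
  refine (measure_mono hsub).trans ?_
  rw [hM, ENNReal.ofReal_mul (by positivity), mul_assoc, ENNReal.ofReal_inv_of_pos (by positivity),
    ← ENNReal.mul_le_iff_le_inv (by simpa using ht) (by simp)]
  exact hcheb.trans (by gcongr)


/-- Hardy–Littlewood–Sobolev inequality on the unit ball of `L^r`. -/
theorem exists_lintegral_norm_integral_norm_rpow_smul_le (hE : 1 ≤ finrank ℝ E) {α : ℝ}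
    (hα0 : 0 < α) {s r : ℝ} (hs : 0 < s) (hr : 1 < r)
    (hsr : 1 / r = 1 / s + α / finrank ℝ E) {F : Type*} [NormedAddCommGroup F] [NormedSpace ℝ F] :
    ∃ C : ℝ, 0 < C ∧ ∀ g : E → F, StronglyMeasurable g → ∫⁻ y, ‖g y‖ₑ ^ r ∂μ ≤ 1 →
      ∫⁻ x, ‖∫ y, ‖x - y‖ ^ (α - (finrank ℝ E : ℝ)) • g y ∂μ‖ₑ ^ s ∂μ ≤ ENNReal.ofReal C := by
  obtain ⟨b, M, hb, hM, h⟩ := exists_meas_lt_lintegral_norm_rpow_mul_le (μ := μ) hE hα0 hs hr hsr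
  have hr0 : 0 < r := by linarith
  set p : ℝ := s - s / r with hp_def
  have hp : 0 < p := sub_pos.mpr (div_lt_self hs hr)
  refine ⟨s * (M * (p⁻¹ * b⁻¹ ^ (r - 1))), by positivity, fun g hg hg1 => ?_⟩
  set f : E → ℝ := fun x => ‖∫ y, ‖x - y‖ ^ (α - (finrank ℝ E : ℝ)) • g y ∂μ‖ with hf
  have hfm : AEMeasurable f μ := by
    have hk : StronglyMeasurable fun z : E × E =>
        ‖z.1 - z.2‖ ^ (α - (finrank ℝ E : ℝ)) • g z.2 :=
      (Measurable.stronglyMeasurable (by fun_prop)).smul (hg.comp_measurable measurable_snd)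
    exact hk.integral_prod_right'.norm.measurable.aemeasurable
  set ν : Measure E := μ.withDensity fun y => ‖g y‖ₑ with hν
  have hgm : Measurable fun y => ‖g y‖ := hg.norm.measurable
  have hgm' : Measurable fun y => ‖g y‖ₑ := hg.enorm
  set u : E → ℝ := fun y => (b⁻¹ * ‖g y‖) ^ (r / s) with hu
  have hum : Measurable u := by fun_prop
  have hlevel (t : ℝ) (ht : 0 < t) :
      μ {x | t < f x} ≤ ENNReal.ofReal (M * t ^ (-(s / r))) * ν {y | t < u y} := by
    have hset : {y | t < u y} = {y | ENNReal.ofReal (b * t ^ (s / r)) < ‖g y‖ₑ} := by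
      ext y
      simp only [hu, mem_ofPred_eq]
      rw [← ofReal_norm, ENNReal.ofReal_lt_ofReal_iff_of_nonneg (by positivity),
        ← inv_div s r, Real.lt_rpow_inv_iff_of_pos ht.le (by positivity) (by positivity),
        lt_inv_mul_iff₀ hb]
    rw [withDensity_apply _ (measurableSet_lt measurable_const hum), hset]
    refine le_trans (measure_mono fun x hx => ?_) (h _ hgm' hg1 t ht)
    refine ((ENNReal.ofReal_lt_ofReal_iff_of_nonneg ht.le).mpr hx).trans_le ?_
    rw [hf, ofReal_norm]
    refine (enorm_integral_le_lintegral_enorm _).trans_eq ?_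
    congr 1 with y
    rw [enorm_smul, Real.enorm_of_nonneg (by positivity)]
  calc ∫⁻ x, ‖∫ y, ‖x - y‖ ^ (α - (finrank ℝ E : ℝ)) • g y ∂μ‖ₑ ^ s ∂μ
      = ∫⁻ x, ENNReal.ofReal (f x ^ s) ∂μ := by
        congr 1 with x
        rw [← ENNReal.ofReal_rpow_of_nonneg (norm_nonneg _) hs.le, ofReal_norm]
    _ = ENNReal.ofReal s * ∫⁻ t in Ioi 0, μ {x | t < f x} * ENNReal.ofReal (t ^ (s - 1)) :=
        lintegral_rpow_eq_lintegral_meas_lt_mul μ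
          (Filter.Eventually.of_forall fun _ => norm_nonneg _) hfm hs
    _ ≤ ENNReal.ofReal s * ∫⁻ t in Ioi 0,
          ENNReal.ofReal M * (ν {y | t < u y} * ENNReal.ofReal (t ^ (p - 1))) := by
        refine mul_le_mul_right (setLIntegral_mono' measurableSet_Ioi fun t ht => ?_) _
        have ht : 0 < t := ht
        have e : t ^ (p - 1) = t ^ (-(s / r)) * t ^ (s - 1) := by
          rw [← Real.rpow_add ht]; congr 1; ring
        refine (mul_le_mul_left (hlevel t ht) _).trans_eq ?_
        rw [e, ENNReal.ofReal_mul hM.le, ENNReal.ofReal_mul (by positivity)]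
        ring
    _ = ENNReal.ofReal s * (ENNReal.ofReal M *
          (ENNReal.ofReal p⁻¹ * ∫⁻ y, ENNReal.ofReal (u y ^ p) ∂ν)) := by
        rw [lintegral_rpow_eq_lintegral_meas_lt_mul ν
          (Filter.Eventually.of_forall fun y => by positivity) hum.aemeasurable hp,
          ← mul_assoc (ENNReal.ofReal p⁻¹), ← ENNReal.ofReal_mul (by positivity),
          inv_mul_cancel₀ hp.ne', ENNReal.ofReal_one, one_mul, lintegral_const_mul' _ _ ENNReal.ofReal_ne_top]
    _ = ENNReal.ofReal s * (ENNReal.ofReal M *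
          (ENNReal.ofReal p⁻¹ * (ENNReal.ofReal (b⁻¹ ^ (r - 1)) * ∫⁻ y, ‖g y‖ₑ ^ r ∂μ))) := by
        rw [lintegral_withDensity_eq_lintegral_mul _ hgm' (by fun_prop),
          ← lintegral_const_mul (ENNReal.ofReal (b⁻¹ ^ (r - 1))) (by fun_prop)]
        congr 3
        refine lintegral_congr fun y => ?_
        have e1 : r / s * p = r - 1 := by rw [hp_def]; field_simp
        have e2 : ‖g y‖ₑ ^ r = ‖g y‖ₑ * ‖g y‖ₑ ^ (r - 1) := by
          conv_lhs => rw [← add_sub_cancel 1 r]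
          rw [ENNReal.rpow_add_of_nonneg _ _ zero_le_one (by linarith), ENNReal.rpow_one]
        rw [Pi.mul_apply, hu, ← Real.rpow_mul (by positivity), e1,
          Real.mul_rpow (by positivity) (norm_nonneg _), ENNReal.ofReal_mul (by positivity),
          ← ENNReal.ofReal_rpow_of_nonneg (norm_nonneg (g y)) (by linarith), ofReal_norm, e2]
        ring
    _ ≤ ENNReal.ofReal s * (ENNReal.ofReal M *
          (ENNReal.ofReal p⁻¹ * (ENNReal.ofReal (b⁻¹ ^ (r - 1)) * 1))) := by gcongr
    _ = ENNReal.ofReal (s * (M * (p⁻¹ * b⁻¹ ^ (r - 1)))) := by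
        rw [mul_one, ← ENNReal.ofReal_mul (by positivity), ← ENNReal.ofReal_mul (by positivity),
          ← ENNReal.ofReal_mul (by positivity)]

end RieszKernel

/-- Hardy–Littlewood–Sobolev inequality for the Riesz potential:
if `1/r = 1/s + α/n` then `‖I_α * g‖_{L^s} ≤ C ‖g‖_{L^r}`. -/
theorem hls_riesz_potential (n : ℕ) (hn : 1 ≤ n) (α : ℝ) (hα0 : 0 < α) (hαn : α < n)
    (s r : ℝ) (hs : 1 ≤ s) (hr : 1 < r) (hsr : 1 / r = 1 / s + α / n) :
    ∃ C : ℝ, 0 < C ∧ ∀ g : EuclideanSpace ℝ (Fin n) → ℂ, Measurable g →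
      eLpNorm (fun x => ∫ y, (‖x - y‖ ^ (α - (n : ℝ))) • g y) (ENNReal.ofReal s) volume
        ≤ ENNReal.ofReal C * eLpNorm g (ENNReal.ofReal r) volume := by
  have hs0 : 0 < s := by linarith
  have hr0 : 0 < r := by linarith
  have hs' : ENNReal.ofReal s ≠ 0 := by simpa using hs0
  have hr' : ENNReal.ofReal r ≠ 0 := by simpa using hr0
  have hfin : finrank ℝ (EuclideanSpace ℝ (Fin n)) = n := by simp
  obtain ⟨C, hC, h⟩ := exists_lintegral_norm_integral_norm_rpow_smul_le
    (μ := (volume : Measure (EuclideanSpace ℝ (Fin n)))) (F := ℂ) (by rw [hfin]; exact hn)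
    hα0 hs0 hr (by rw [hfin]; exact hsr)
  rw [hfin] at h
  refine ⟨C ^ (1 / s), by positivity, fun g hg => ?_⟩
  set N := eLpNorm g (ENNReal.ofReal r) volume with hN
  rcases eq_or_ne N 0 with h0 | h0
  · have hg0 : g =ᵐ[volume] 0 := (eLpNorm_eq_zero_iff hg.aestronglyMeasurable hr').mp h0
    have hz : (fun x => ∫ y, (‖x - y‖ ^ (α - (n : ℝ))) • g y) = 0 := by
      ext x
      refine integral_eq_zero_of_ae ?_
      filter_upwards [hg0] with y hy
      simp [hy]
    rw [hz, eLpNorm_zero]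
    exact zero_le
  rcases eq_or_ne N ⊤ with ht | ht
  · rw [ht, ENNReal.mul_top (by simpa using Real.rpow_pos_of_pos hC _)]
    exact le_top
  set c : ℝ := N.toReal with hc
  have hc0 : 0 < c := ENNReal.toReal_pos h0 ht
  have hcN : ‖c‖ₑ = N := by
    rw [Real.enorm_of_nonneg hc0.le, hc, ENNReal.ofReal_toReal ht]
  have hnorm : ∫⁻ y, ‖(c⁻¹ • g) y‖ₑ ^ r ≤ 1 := by
    have h1 : eLpNorm (c⁻¹ • g) (ENNReal.ofReal r) volume = 1 := by
      rw [eLpNorm_const_smul, enorm_inv hc0.ne', hcN, ENNReal.inv_mul_cancel h0 ht]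
    rw [eLpNorm_eq_lintegral_rpow_enorm_toReal hr' ENNReal.ofReal_ne_top,
      ENNReal.toReal_ofReal hr0.le] at h1
    rw [one_div] at h1
    exact ((ENNReal.rpow_inv_le_iff hr0).mp h1.le).trans_eq (ENNReal.one_rpow r)
  have key := h (c⁻¹ • g) (hg.stronglyMeasurable.const_smul _) hnorm
  have hsmul : (fun x => ∫ y, (‖x - y‖ ^ (α - (n : ℝ))) • g y) =
      c • fun x => ∫ y, (‖x - y‖ ^ (α - (n : ℝ))) • (c⁻¹ • g) y := by
    ext x
    rw [Pi.smul_apply, ← integral_smul]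
    congr 1 with y
    rw [Pi.smul_apply, smul_comm c, smul_inv_smul₀ hc0.ne']
  rw [hsmul, eLpNorm_const_smul, hcN, mul_comm,
    eLpNorm_eq_lintegral_rpow_enorm_toReal hs' ENNReal.ofReal_ne_top, ENNReal.toReal_ofReal hs0.le,
    ← ENNReal.ofReal_rpow_of_nonneg hC.le (by positivity)]
  gcongr
end

section
/- (Caffarelli–Kohn–Nirenberg weighted interpolation, special case.) Let n ≥ 1, 1 < p ≤ q < ∞, and let a, b be real numbers with −n/q < b ≤ a < n(1 − 1/p) and a − b − 1 = n(1/q − 1/p). Then there exists a constant C > 0 such that for every f ∈ C_c^∞(ℝⁿ, ℂ), ‖ |x|^b f ‖_{L^q(ℝⁿ)} ≤ C ‖ |x|^a ∇f ‖_{L^p(ℝⁿ)}. -/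
open MeasureTheory

lemma HasCompactSupport.norm_rpow {X F : Type*} [TopologicalSpace X] [NormedAddCommGroup F]
    {f : X → F} (h2f : HasCompactSupport f) {r : ℝ} (hr : 0 < r) :
    HasCompactSupport fun x ↦ ‖f x‖ ^ r :=
  h2f.comp_left (g := fun v : F ↦ ‖v‖ ^ r) (by simp [hr.ne'])

/-- A smooth regularization of the norm. -/
noncomputable def regNorm {E : Type*} [Norm E] (ε : ℝ) (x : E) : ℝ := √(‖x‖ ^ 2 + ε ^ 2)

section RegNorm

variable {E : Type*} [NormedAddCommGroup E] {ε : ℝ}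

lemma regNorm_pos (hε : ε ≠ 0) (x : E) : 0 < regNorm ε x :=
  Real.sqrt_pos.2 (by positivity)

lemma norm_le_regNorm (ε : ℝ) (x : E) : ‖x‖ ≤ regNorm ε x :=
  Real.le_sqrt_of_sq_le (by linarith [sq_nonneg ε])

lemma continuous_regNorm (ε : ℝ) : Continuous (regNorm ε : E → ℝ) := by
  unfold regNorm
  fun_prop

lemma continuous_regNorm_rpow (hε : ε ≠ 0) (γ : ℝ) :
    Continuous fun x : E ↦ regNorm ε x ^ γ :=
  (continuous_regNorm ε).rpow_const fun x ↦ Or.inl (regNorm_pos hε x).ne'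

variable [InnerProductSpace ℝ E]

lemma hasFDerivAt_regNorm_rpow (hε : ε ≠ 0) (γ : ℝ) (x : E) :
    HasFDerivAt (fun x ↦ regNorm ε x ^ γ) ((γ * regNorm ε x ^ (γ - 2)) • innerSL ℝ x) x := by
  have h1 : HasFDerivAt (fun x : E ↦ ‖x‖ ^ 2 + ε ^ 2) (2 • innerSL ℝ x) x :=
    (hasStrictFDerivAt_norm_sq x).hasFDerivAt.add_const _
  have hpos : 0 < ‖x‖ ^ 2 + ε ^ 2 := by positivity
  have h2 := (h1.sqrt hpos.ne').rpow_const (p := γ) (Or.inl (Real.sqrt_pos.2 hpos).ne')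
  refine h2.congr_fderiv ?_
  have hw := regNorm_pos hε x
  change (γ * regNorm ε x ^ (γ - 1)) • (1 / (2 * regNorm ε x)) • _ = _
  rw [← Nat.cast_smul_eq_nsmul ℝ, smul_smul, smul_smul]
  congr 1
  rw [show γ - 1 = γ - 2 + 1 by ring, Real.rpow_add_one hw.ne']
  push_cast
  field_simp

lemma contDiff_regNorm_rpow (hε : ε ≠ 0) (γ : ℝ) :
    ContDiff ℝ 1 fun x : E ↦ regNorm ε x ^ γ := by
  have hpos : ∀ x : E, 0 < ‖x‖ ^ 2 + ε ^ 2 := fun x ↦ by positivity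
  have h : ContDiff ℝ 1 fun x : E ↦ ‖x‖ ^ 2 + ε ^ 2 :=
    (contDiff_norm_sq ℝ).add contDiff_const
  exact (h.sqrt fun x ↦ (hpos x).ne').rpow_const_of_ne fun x ↦ (Real.sqrt_pos.2 (hpos x)).ne'

variable {F : Type*} [NormedAddCommGroup F] [InnerProductSpace ℝ F] {f : E → F} {r : ℝ}

lemma contDiff_regNorm_rpow_mul_norm_rpow (hε : ε ≠ 0) (γ : ℝ) (hf : ContDiff ℝ 1 f)
    (hr : 1 < r) : ContDiff ℝ 1 fun x ↦ regNorm ε x ^ γ * ‖f x‖ ^ r :=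
  (contDiff_regNorm_rpow hε γ).mul (hf.norm_rpow hr)

lemma fderiv_regNorm_rpow_mul_norm_rpow (hε : ε ≠ 0) (γ : ℝ) (hf : ContDiff ℝ 1 f)
    (hr : 1 < r) (x : E) :
    fderiv ℝ (fun x ↦ regNorm ε x ^ γ * ‖f x‖ ^ r) x =
      regNorm ε x ^ γ • fderiv ℝ (fun x ↦ ‖f x‖ ^ r) x +
        ‖f x‖ ^ r • (γ * regNorm ε x ^ (γ - 2)) • innerSL ℝ x :=
  ((hasFDerivAt_regNorm_rpow hε γ x).mul
    ((hf.norm_rpow hr).differentiable one_ne_zero x).hasFDerivAt).fderiv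

lemma norm_fderiv_regNorm_rpow_mul_norm_rpow_le (hε : ε ≠ 0) (γ : ℝ) (hf : ContDiff ℝ 1 f)
    (hr : 1 < r) (x : E) :
    ‖fderiv ℝ (fun x ↦ regNorm ε x ^ γ * ‖f x‖ ^ r) x‖ ≤
      r * (regNorm ε x ^ γ * ‖f x‖ ^ (r - 1) * ‖fderiv ℝ f x‖) +
        |γ| * (regNorm ε x ^ (γ - 1) * ‖f x‖ ^ r) := by
  have hw := regNorm_pos hε x
  rw [fderiv_regNorm_rpow_mul_norm_rpow hε γ hf hr]
  refine (norm_add_le _ _).trans (add_le_add ?_ ?_)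
  · rw [norm_smul, Real.norm_of_nonneg (Real.rpow_nonneg hw.le _)]
    calc _ ≤ regNorm ε x ^ γ * (r * ‖f x‖ ^ (r - 1) * ‖fderiv ℝ f x‖) := by
          gcongr
          exact norm_fderiv_norm_rpow_le (hf.differentiable one_ne_zero) hr
      _ = _ := by ring
  · rw [norm_smul, norm_smul, innerSL_apply_norm, norm_mul, Real.norm_eq_abs γ,
      Real.norm_of_nonneg (by positivity), Real.norm_of_nonneg (by positivity)]
    calc _ ≤ ‖f x‖ ^ r * (|γ| * regNorm ε x ^ (γ - 2) * regNorm ε x) := by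
          gcongr
          exact norm_le_regNorm ε x
      _ = _ := by
          rw [show γ - 1 = γ - 2 + 1 by ring, Real.rpow_add_one hw.ne']
          ring

end RegNorm

section Integrals

variable {E : Type*} [NormedAddCommGroup E] [InnerProductSpace ℝ E] [FiniteDimensional ℝ E]
  [MeasurableSpace E] [BorelSpace E]

/-- Euler's identity `∫ ⟨x, ∇g⟩ = -n ∫ g`. -/
lemma integral_fderiv_apply_self {g : E → ℝ} (hg : ContDiff ℝ 1 g) (h2g : HasCompactSupport g) :
    ∫ x, fderiv ℝ g x x = -(Module.finrank ℝ E * ∫ x, g x) := by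
  let e := stdOrthonormalBasis ℝ E
  have hg' : Continuous (fderiv ℝ g) := hg.continuous_fderiv one_ne_zero
  have hint : ∀ i, Integrable fun x ↦ inner ℝ (e i) x * fderiv ℝ g x (e i) := fun i ↦
    Continuous.integrable_of_hasCompactSupport (by fun_prop)
      ((h2g.fderiv_apply ℝ (e i)).mul_left)
  have hgi : Integrable g := hg.continuous.integrable_of_hasCompactSupport h2g
  have hcoord : ∀ i, ∫ x, inner ℝ (e i) x * fderiv ℝ g x (e i) = -∫ x, g x := by
    intro i
    have hd : ∀ x, fderiv ℝ (fun x ↦ inner ℝ (e i) x) x (e i) = 1 := fun x ↦ by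
      have : HasFDerivAt (fun x ↦ inner ℝ (e i) x) (innerSL ℝ (e i)) x :=
        (innerSL ℝ (e i)).hasFDerivAt
      rw [this.fderiv, innerSL_apply_apply, real_inner_self_eq_norm_sq, e.norm_eq_one, one_pow]
    rw [integral_mul_fderiv_eq_neg_fderiv_mul_of_integrable]
    · simp only [hd, one_mul]
    · simpa only [hd, one_mul] using hgi
    · exact hint i
    · exact Continuous.integrable_of_hasCompactSupport
        ((innerSL ℝ (e i)).continuous.mul hg.continuous) h2g.mul_left
    · exact fun x _ ↦ (innerSL ℝ (e i)).differentiableAt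
    · exact fun x _ ↦ hg.differentiable one_ne_zero x
  calc ∫ x, fderiv ℝ g x x = ∫ x, ∑ i, inner ℝ (e i) x * fderiv ℝ g x (e i) := by
        congr with x
        conv_lhs => arg 2; rw [← e.sum_repr' x]
        simp [map_sum]
    _ = _ := by
        rw [integral_finsetSum _ fun i _ ↦ hint i]
        simp [hcoord]

/-- In dimension one, a compactly supported function is bounded by the `L¹` norm of its
derivative. -/
lemma abs_le_integral_norm_fderiv_of_finrank_eq_one (hE : Module.finrank ℝ E = 1) {h : E → ℝ}
    (hh : ContDiff ℝ 1 h) (h2h : HasCompactSupport h) (x : E) :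
    |h x| ≤ ∫ y, ‖fderiv ℝ h y‖ := by
  have : Nontrivial E := Module.nontrivial_of_finrank_pos (R := ℝ) (by omega)
  obtain ⟨v, hv⟩ := exists_norm_eq E zero_le_one
  let L : ℝ ≃ₗᵢ[ℝ] E :=
    (LinearIsometry.toSpanSingleton ℝ E hv).toLinearIsometryEquiv (by simp [hE])
  have hL : ContDiff ℝ 1 (h ∘ L) := hh.comp L.contDiff
  have h2L : HasCompactSupport (h ∘ L) := h2h.comp_homeomorph L.toHomeomorph
  have hbound : ∀ t, ‖deriv (h ∘ L) t‖ₑ ≤ ‖fderiv ℝ h (L t)‖ₑ := by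
    intro t
    have h1 : HasDerivAt L (L 1) t := by
      simpa using (L : ℝ →L[ℝ] E).hasDerivAt (x := t)
    have h2 := ((hh.differentiable one_ne_zero (L t)).hasFDerivAt.comp_hasDerivAt t h1).deriv
    rw [h2, enorm_le_iff_norm_le]
    refine ((fderiv ℝ h (L t)).le_opNorm _).trans ?_
    rw [L.norm_map, norm_one, mul_one]
  have hint : Integrable fun y ↦ ‖fderiv ℝ h y‖ :=
    ((hh.continuous_fderiv one_ne_zero).integrable_of_hasCompactSupport (h2h.fderiv ℝ)).norm
  have key : ‖h x‖ₑ ≤ ∫⁻ y, ‖fderiv ℝ h y‖ₑ := by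
    calc ‖h x‖ₑ = ‖(h ∘ L) (L.symm x)‖ₑ := by simp
      _ ≤ ∫⁻ t in Set.Iic (L.symm x), ‖deriv (h ∘ L) t‖ₑ :=
          h2L.enorm_le_lintegral_Ici_deriv hL _
      _ ≤ ∫⁻ t, ‖deriv (h ∘ L) t‖ₑ := setLIntegral_le_lintegral _ _
      _ ≤ ∫⁻ t, ‖fderiv ℝ h (L t)‖ₑ := lintegral_mono hbound
      _ = _ := L.measurePreserving.lintegral_comp_emb
          L.toHomeomorph.measurableEmbedding (fun y ↦ ‖fderiv ℝ h y‖ₑ)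
  rw [← ofReal_norm, Real.norm_eq_abs] at key
  simp_rw [← ofReal_norm] at key
  rw [← ofReal_integral_eq_lintegral_ofReal hint (ae_of_all _ fun y ↦ norm_nonneg _)] at key
  exact (ENNReal.ofReal_le_ofReal_iff (integral_nonneg fun y ↦ norm_nonneg _)).1 key

/-- The Gagliardo–Nirenberg–Sobolev inequality for `p = 1`, in terms of Bochner integrals. -/
lemma exists_integral_rpow_le_integral_norm_fderiv {m : ℝ}
    (hm : Real.HolderConjugate (Module.finrank ℝ E) m) :
    ∃ C : ℝ, 0 ≤ C ∧ ∀ h : E → ℝ, ContDiff ℝ 1 h → HasCompactSupport h →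
      ∫ x, |h x| ^ m ≤ C * (∫ x, ‖fderiv ℝ h x‖) ^ m := by
  refine ⟨lintegralPowLePowLIntegralFDerivConst (volume : Measure E) m, NNReal.coe_nonneg _,
    fun h hh h2h ↦ ?_⟩
  have hm0 : 0 < m := hm.symm.pos
  have hint : Integrable fun y ↦ ‖fderiv ℝ h y‖ :=
    ((hh.continuous_fderiv one_ne_zero).integrable_of_hasCompactSupport (h2h.fderiv ℝ)).norm
  have hintm : Integrable fun x ↦ |h x| ^ m :=
    (hh.continuous.abs.rpow_const fun _ ↦ Or.inr hm0.le).integrable_of_hasCompactSupport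
      (h2h.comp_left (g := fun t : ℝ ↦ |t| ^ m) (by simp [hm0.ne']))
  have key := lintegral_pow_le_pow_lintegral_fderiv volume hh h2h hm
  have e1 : ∀ x, ‖h x‖ₑ ^ m = ENNReal.ofReal (|h x| ^ m) := fun x ↦ by
    rw [← ofReal_norm, Real.norm_eq_abs,
      ENNReal.ofReal_rpow_of_nonneg (abs_nonneg _) hm0.le]
  simp_rw [e1, ← ofReal_norm] at key
  have hI : 0 ≤ ∫ y, ‖fderiv ℝ h y‖ := integral_nonneg fun y ↦ norm_nonneg _
  rw [← ofReal_integral_eq_lintegral_ofReal hint (ae_of_all _ fun y ↦ norm_nonneg _),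
    ← ofReal_integral_eq_lintegral_ofReal hintm (ae_of_all _ fun y ↦ by positivity),
    ENNReal.ofReal_rpow_of_nonneg hI hm0.le, ← ENNReal.ofReal_coe_nnreal,
    ← ENNReal.ofReal_mul (NNReal.coe_nonneg _)] at key
  exact (ENNReal.ofReal_le_ofReal_iff (by positivity)).1 key

/-- Interpolation between `L¹` and the `L¹` Sobolev inequality: if `U = w ^ (n - 1) * h`, then
`∫ U ^ s w ^ (-n)` is controlled by the larger of `∫ U w ^ (-n)` and `∫ ‖∇h‖`. -/
lemma exists_integral_weighted_rpow_le {s : ℝ} (hE : 1 ≤ Module.finrank ℝ E) (hs : 1 ≤ s)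
    (hs' : 1 - 1 / (Module.finrank ℝ E : ℝ) ≤ 1 / s) :
    ∃ C : ℝ, 0 < C ∧ ∀ w h : E → ℝ, Continuous w → (∀ x, 0 < w x) → ContDiff ℝ 1 h →
      HasCompactSupport h → (∀ x, 0 ≤ h x) → ∀ K : ℝ, 0 ≤ K →
      ∫ x, w x ^ (-1 : ℝ) * h x ≤ K → ∫ x, ‖fderiv ℝ h x‖ ≤ K →
      ∫ x, (w x ^ ((Module.finrank ℝ E : ℝ) - 1) * h x) ^ s * w x ^ (-(Module.finrank ℝ E : ℝ))
        ≤ C * K ^ s := by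
  set n := Module.finrank ℝ E with hn
  suffices H : ∃ C : ℝ, 0 < C ∧ ∀ w h : E → ℝ, Continuous w → (∀ x, 0 < w x) → ContDiff ℝ 1 h →
      HasCompactSupport h → (∀ x, 0 ≤ h x) → ∀ K : ℝ, 0 < K →
      ∫ x, w x ^ (-1 : ℝ) * h x ≤ K → ∫ x, ‖fderiv ℝ h x‖ ≤ K →
      ∫ x, (w x ^ ((n : ℝ) - 1) * h x) ^ s * w x ^ (-(n : ℝ)) ≤ C * K ^ s by
    obtain ⟨C, hC, H⟩ := H
    refine ⟨C, hC, fun w h hw hw0 hh h2h hh0 K hK h1 h2 ↦ ?_⟩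
    have hcont : Continuous fun K : ℝ ↦ C * K ^ s :=
      continuous_const.mul (Real.continuous_rpow_const (by linarith))
    refine ge_of_tendsto (hcont.continuousWithinAt (s := Set.Ioi K) (x := K)).tendsto ?_
    filter_upwards [self_mem_nhdsWithin] with K' hK'
    have hK' : K < K' := hK'
    exact H w h hw hw0 hh h2h hh0 K' (hK.trans_lt hK') (h1.trans hK'.le) (h2.trans hK'.le)
  have hs0 : s ≠ 0 := by positivity
  have key : ∀ w h : E → ℝ, Continuous w → (∀ x, 0 < w x) → ContDiff ℝ 1 h →
      HasCompactSupport h → ∀ t : ℝ, 0 < t →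
      Integrable fun x ↦ (w x ^ ((n : ℝ) - 1) * h x) ^ t * w x ^ (-(n : ℝ)) := by
    intro w h hw hw0 hh h2h t ht
    have hwc : ∀ γ : ℝ, Continuous fun x ↦ w x ^ γ := fun γ ↦
      hw.rpow_const fun x ↦ Or.inl (hw0 x).ne'
    refine Continuous.integrable_of_hasCompactSupport
      ((((hwc _).mul hh.continuous).rpow_const fun _ ↦ Or.inr ht.le).mul (hwc _)) ?_
    refine h2h.mono fun x hx hx0 ↦ hx ?_
    simp [hx0, ht.ne']
  have e1 : ∀ w h : E → ℝ, (∀ x, 0 < w x) → ∀ x,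
      (w x ^ ((n : ℝ) - 1) * h x) ^ (1 : ℝ) * w x ^ (-(n : ℝ)) = w x ^ (-1 : ℝ) * h x := by
    intro w h hw0 x
    rw [Real.rpow_one, mul_right_comm, ← Real.rpow_add (hw0 x)]
    ring_nf
  rcases hE.eq_or_lt with h1 | h1
  · refine ⟨1, one_pos, fun w h hw hw0 hh h2h hh0 K hK hK1 hK2 ↦ ?_⟩
    have hn1 : (n : ℝ) = 1 := by exact_mod_cast h1.symm
    calc _ ≤ ∫ x, K ^ (s - 1) *
          ((w x ^ ((n : ℝ) - 1) * h x) ^ (1 : ℝ) * w x ^ (-(n : ℝ))) := by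
          refine integral_mono (key w h hw hw0 hh h2h s (by positivity))
            ((key w h hw hw0 hh h2h 1 one_pos).const_mul _) fun x ↦ ?_
          have hhx : h x ≤ K := (le_abs_self _).trans
            ((abs_le_integral_norm_fderiv_of_finrank_eq_one h1.symm hh h2h x).trans hK2)
          simp only [hn1, sub_self, Real.rpow_zero, one_mul, Real.rpow_one, ← mul_assoc]
          gcongr ?_ * _
          · exact Real.rpow_nonneg (hw0 x).le _
          · rcases (hh0 x).eq_or_lt with h0 | h0
            · simp [← h0, hs0]
            calc h x ^ s = h x ^ (s - 1) * h x := by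
                  rw [← Real.rpow_add_one h0.ne', sub_add_cancel]
              _ ≤ _ := by gcongr
      _ = K ^ (s - 1) * ∫ x, w x ^ (-1 : ℝ) * h x := by
          rw [integral_const_mul]
          simp_rw [e1 w h hw0]
      _ ≤ K ^ (s - 1) * K := by gcongr
      _ = 1 * K ^ s := by rw [← Real.rpow_add_one hK.ne', sub_add_cancel, one_mul]
  · have hn1 : (1 : ℝ) < n := by exact_mod_cast h1
    set m : ℝ := Real.conjExponent n with hmdef
    have hm : Real.HolderConjugate (n : ℝ) m := Real.HolderConjugate.conjExponent hn1
    have hm0 : 0 < m := hm.symm.pos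
    have hminv : 1 / m = 1 - 1 / (n : ℝ) := by
      have := hm.inv_add_inv_eq_one
      simp only [one_div]
      linarith
    have hsm : s ≤ m := by
      rw [← hminv] at hs'
      exact (one_div_le_one_div hm0 (by positivity)).1 hs'
    obtain ⟨C, hC, HC⟩ := exists_integral_rpow_le_integral_norm_fderiv (E := E) (m := m) hm
    refine ⟨1 + C, by positivity, fun w h hw hw0 hh h2h hh0 K hK hK1 hK2 ↦ ?_⟩
    have em : ∀ x, (w x ^ ((n : ℝ) - 1) * h x) ^ m * w x ^ (-(n : ℝ)) = |h x| ^ m := fun x ↦ by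
      have hwx := hw0 x
      rw [Real.mul_rpow (by positivity) (hh0 x), ← Real.rpow_mul hwx.le, mul_right_comm,
        ← Real.rpow_add hwx, abs_of_nonneg (hh0 x)]
      have : ((n : ℝ) - 1) * m + -n = 0 := by
        rw [hmdef, Real.conjExponent]
        field_simp [sub_ne_zero.2 hn1.ne']
        ring
      rw [this, Real.rpow_zero, one_mul]
    calc _ ≤ ∫ x, (K ^ (s - 1) *
            ((w x ^ ((n : ℝ) - 1) * h x) ^ (1 : ℝ) * w x ^ (-(n : ℝ))) +
          K ^ (s - m) * ((w x ^ ((n : ℝ) - 1) * h x) ^ m * w x ^ (-(n : ℝ)))) := by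
          refine integral_mono (key w h hw hw0 hh h2h s (by positivity))
            (((key w h hw hw0 hh h2h 1 one_pos).const_mul _).add
              ((key w h hw hw0 hh h2h m hm0).const_mul _)) fun x ↦ ?_
          have hwx := hw0 x
          have hu : 0 ≤ w x ^ ((n : ℝ) - 1) * h x := mul_nonneg (by positivity) (hh0 x)
          simp only [← mul_assoc, ← add_mul]
          gcongr ?_ * _
          generalize w x ^ ((n : ℝ) - 1) * h x = u at hu
          rcases hu.eq_or_lt with h0 | h0
          · simp [← h0, hs0, hm0.ne']
          rcases le_total u K with huK | huK
          · calc u ^ s = u ^ (s - 1) * u ^ (1 : ℝ) := by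
                  rw [← Real.rpow_add h0, sub_add_cancel]
              _ ≤ K ^ (s - 1) * u ^ (1 : ℝ) := by gcongr
              _ ≤ _ := le_add_of_nonneg_right (by positivity)
          · calc u ^ s = u ^ (s - m) * u ^ m := by rw [← Real.rpow_add h0, sub_add_cancel]
              _ ≤ K ^ (s - m) * u ^ m := by
                  gcongr ?_ * _
                  exact Real.rpow_le_rpow_of_nonpos hK huK (by linarith)
              _ ≤ _ := le_add_of_nonneg_left (by positivity)
      _ = K ^ (s - 1) * (∫ x, w x ^ (-1 : ℝ) * h x) + K ^ (s - m) * ∫ x, |h x| ^ m := by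
          rw [integral_add ((key w h hw hw0 hh h2h 1 one_pos).const_mul _)
            ((key w h hw hw0 hh h2h m hm0).const_mul _), integral_const_mul, integral_const_mul]
          simp_rw [e1 w h hw0, em]
      _ ≤ K ^ (s - 1) * K + K ^ (s - m) * (C * K ^ m) := by
          gcongr
          refine (HC h hh h2h).trans ?_
          gcongr
      _ = (1 + C) * K ^ s := by
          rw [← Real.rpow_add_one hK.ne', sub_add_cancel, mul_left_comm, ← Real.rpow_add hK,
            sub_add_cancel]
          ring

variable {F : Type*} [NormedAddCommGroup F] {ε : ℝ}

lemma integrable_regNorm_rpow_mul {g : E → ℝ} (hε : ε ≠ 0) (γ : ℝ) (hg : Continuous g)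
    (h2g : HasCompactSupport g) : Integrable fun x ↦ regNorm ε x ^ γ * g x :=
  ((continuous_regNorm_rpow hε γ).mul hg).integrable_of_hasCompactSupport h2g.mul_left

lemma integrable_regNorm_rpow_mul_norm_rpow {f : E → F} (hε : ε ≠ 0) (γ : ℝ) (hf : Continuous f)
    (h2f : HasCompactSupport f) {r : ℝ} (hr : 0 < r) :
    Integrable fun x ↦ regNorm ε x ^ γ * ‖f x‖ ^ r :=
  integrable_regNorm_rpow_mul hε γ (hf.norm.rpow_const fun _ ↦ Or.inr hr.le) (h2f.norm_rpow hr)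

variable [InnerProductSpace ℝ F]

lemma integrable_regNorm_rpow_mul_norm_rpow_mul_norm_fderiv {f : E → F} (hε : ε ≠ 0) (γ : ℝ)
    (hf : ContDiff ℝ 1 f) (h2f : HasCompactSupport f) {r : ℝ} (hr : 0 < r) :
    Integrable fun x ↦ regNorm ε x ^ γ * ‖f x‖ ^ r * ‖fderiv ℝ f x‖ := by
  simp_rw [mul_assoc]
  exact integrable_regNorm_rpow_mul hε γ
    ((hf.continuous.norm.rpow_const fun _ ↦ Or.inr hr.le).mul
      (hf.continuous_fderiv one_ne_zero).norm) (h2f.norm_rpow hr).mul_right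

/-- A Hardy inequality in `L¹` form with regularized weights. -/
lemma min_finrank_mul_integral_regNorm_rpow_le (hε : ε ≠ 0) (β : ℝ) {f : E → F} (hf : ContDiff ℝ 1 f)
    (h2f : HasCompactSupport f) {r : ℝ} (hr : 1 < r) :
    min (Module.finrank ℝ E : ℝ) (Module.finrank ℝ E + β) *
        ∫ x, regNorm ε x ^ β * ‖f x‖ ^ r ≤
      r * ∫ x, regNorm ε x ^ (β + 1) * ‖f x‖ ^ (r - 1) * ‖fderiv ℝ f x‖ := by
  set n : ℝ := (Module.finrank ℝ E : ℝ)
  have hr0 : 0 < r := by linarith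
  set g : E → ℝ := fun x ↦ regNorm ε x ^ β * ‖f x‖ ^ r with hg
  have hgc : ContDiff ℝ 1 g := contDiff_regNorm_rpow_mul_norm_rpow hε β hf hr
  have h2g : HasCompactSupport g := (h2f.norm_rpow hr0).mul_left
  have hgi : Integrable g := hgc.continuous.integrable_of_hasCompactSupport h2g
  have hgd : Integrable fun x ↦ fderiv ℝ g x x :=
    Continuous.integrable_of_hasCompactSupport
      ((hgc.continuous_fderiv one_ne_zero).clm_apply continuous_id)
      ((h2g.fderiv ℝ).mono fun x hx hx0 ↦ hx (by simp [hx0]))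
  have hT := integrable_regNorm_rpow_mul_norm_rpow_mul_norm_fderiv hε (β + 1) hf h2f
    (sub_pos.2 hr)
  have hsum : Integrable fun x ↦ n * g x + fderiv ℝ g x x := (hgi.const_mul _).add hgd
  have hEuler := integral_fderiv_apply_self hgc h2g
  have hpt : ∀ x, min n (n + β) * g x ≤ n * g x + fderiv ℝ g x x +
      r * (regNorm ε x ^ (β + 1) * ‖f x‖ ^ (r - 1) * ‖fderiv ℝ f x‖) := by
    intro x
    have hw := regNorm_pos hε x
    have hxw := norm_le_regNorm ε x
    have hfd : fderiv ℝ g x x = regNorm ε x ^ β * fderiv ℝ (fun x ↦ ‖f x‖ ^ r) x x +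
        β * (‖x‖ ^ 2 / regNorm ε x ^ 2) * g x := by
      rw [hg, fderiv_regNorm_rpow_mul_norm_rpow hε β hf hr]
      simp only [add_apply, smul_apply, smul_eq_mul,
        innerSL_apply_apply, real_inner_self_eq_norm_sq]
      rw [show β - 2 = β - (2 : ℕ) by norm_num, Real.rpow_sub_natCast hw.ne']
      ring
    have h1 : -(r * (regNorm ε x ^ (β + 1) * ‖f x‖ ^ (r - 1) * ‖fderiv ℝ f x‖)) ≤
        regNorm ε x ^ β * fderiv ℝ (fun x ↦ ‖f x‖ ^ r) x x := by
      refine neg_le_of_abs_le ?_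
      rw [abs_mul, abs_of_pos (Real.rpow_pos_of_pos hw β), ← Real.norm_eq_abs]
      calc _ ≤ regNorm ε x ^ β * ((r * ‖f x‖ ^ (r - 1) * ‖fderiv ℝ f x‖) * regNorm ε x) := by
            gcongr
            refine (ContinuousLinearMap.le_opNorm _ _).trans ?_
            gcongr
            exact norm_fderiv_norm_rpow_le (hf.differentiable one_ne_zero) hr
        _ = _ := by
            rw [Real.rpow_add_one hw.ne']
            ring
    have h2 : min n (n + β) ≤ n + β * (‖x‖ ^ 2 / regNorm ε x ^ 2) := by
      have h0 : 0 ≤ ‖x‖ ^ 2 / regNorm ε x ^ 2 := by positivity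
      have h1 : ‖x‖ ^ 2 / regNorm ε x ^ 2 ≤ 1 := by
        rw [div_le_one (by positivity)]
        gcongr
      rcases le_total 0 β with hβ | hβ
      · exact (min_le_left _ _).trans (le_add_of_nonneg_right (by positivity))
      · exact (min_le_right _ _).trans (by nlinarith)
    have h3 : 0 ≤ g x := by positivity
    have h4 := mul_le_mul_of_nonneg_right h2 h3
    rw [hfd]
    linarith
  calc _ = ∫ x, min n (n + β) * g x := (integral_const_mul _ _).symm
    _ ≤ ∫ x, (n * g x + fderiv ℝ g x x +
          r * (regNorm ε x ^ (β + 1) * ‖f x‖ ^ (r - 1) * ‖fderiv ℝ f x‖)) :=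
        integral_mono (hgi.const_mul _) (hsum.add (hT.const_mul _)) hpt
    _ = _ := by
        rw [integral_add hsum (hT.const_mul _),
          integral_add (hgi.const_mul _) hgd, integral_const_mul, integral_const_mul, hEuler]
        ring

/-- The `L¹` norm of the gradient of `w ^ (β + 1) * ‖f‖ ^ r`. -/
lemma integral_norm_fderiv_regNorm_rpow_mul_norm_rpow_le (hε : ε ≠ 0) (β : ℝ) {f : E → F}
    (hf : ContDiff ℝ 1 f) (h2f : HasCompactSupport f) {r : ℝ} (hr : 1 < r) :
    ∫ x, ‖fderiv ℝ (fun x ↦ regNorm ε x ^ (β + 1) * ‖f x‖ ^ r) x‖ ≤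
      r * (∫ x, regNorm ε x ^ (β + 1) * ‖f x‖ ^ (r - 1) * ‖fderiv ℝ f x‖) +
        |β + 1| * ∫ x, regNorm ε x ^ β * ‖f x‖ ^ r := by
  have hr0 : 0 < r := by linarith
  have hT := integrable_regNorm_rpow_mul_norm_rpow_mul_norm_fderiv hε (β + 1) hf h2f
    (sub_pos.2 hr)
  have hI := integrable_regNorm_rpow_mul_norm_rpow hε β hf.continuous h2f hr0
  rw [← integral_const_mul, ← integral_const_mul,
    ← integral_add (hT.const_mul _) (hI.const_mul _)]
  refine integral_mono ?_ ((hT.const_mul _).add (hI.const_mul _)) fun x ↦ ?_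
  · exact (((contDiff_regNorm_rpow_mul_norm_rpow hε _ hf hr).continuous_fderiv
      one_ne_zero).integrable_of_hasCompactSupport
      (((h2f.norm_rpow hr0).mul_left).fderiv ℝ)).norm
  · simpa using norm_fderiv_regNorm_rpow_mul_norm_rpow_le hε (β + 1) hf hr x

/-- The Caffarelli–Kohn–Nirenberg inequality with regularized weights, uniformly in the
regularization parameter. -/
lemma exists_regNorm_weighted_interpolation {p q a b : ℝ} (hE : 1 ≤ Module.finrank ℝ E)
    (hp : 1 < p) (hpq : p ≤ q) (hb : -((Module.finrank ℝ E : ℝ) / q) < b) (hba : b ≤ a)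
    (hrel : a - b - 1 = (Module.finrank ℝ E : ℝ) * (1 / q - 1 / p)) :
    ∃ C : ℝ, 0 < C ∧ ∀ ε : ℝ, ε ≠ 0 → ∀ f : E → F, ContDiff ℝ 1 f → HasCompactSupport f →
      (∫ x, regNorm ε x ^ (b * q) * ‖f x‖ ^ q) ^ (1 / q) ≤
        C * (∫ x, regNorm ε x ^ (a * p) * ‖fderiv ℝ f x‖ ^ p) ^ (1 / p) := by
  set n : ℝ := (Module.finrank ℝ E : ℝ) with hn
  have hn1 : 1 ≤ n := by
    rw [hn]
    exact_mod_cast hE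
  have hp0 : 0 < p := by linarith
  have hq0 : 0 < q := by linarith
  set p' : ℝ := Real.conjExponent p with hp'
  have hpp' : p.HolderConjugate p' := Real.HolderConjugate.conjExponent hp
  have hp'0 : 0 < p' := hpp'.symm.pos
  have hp'inv : 1 / p' = 1 - 1 / p := by
    have := hpp'.inv_add_inv_eq_one
    simp only [one_div]
    linarith
  set r : ℝ := 1 + q / p' with hrdef
  have hr : 1 < r := by rw [hrdef]; linarith [div_pos hq0 hp'0]
  have hr0 : 0 < r := by linarith
  set κ : ℝ := b + n / q with hκ
  have hκ0 : 0 < κ := by rw [hκ]; linarith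
  have hκa : κ = a - 1 + n / p := by
    rw [hκ]
    have : n * (1 / q - 1 / p) = n / q - n / p := by ring
    linarith
  set s : ℝ := q / r with hs
  have hsinv : 1 / s = 1 / q + 1 / p' := by
    rw [hs, hrdef]
    field_simp
  have hs0 : 0 < s := by positivity
  have hs1 : 1 ≤ s := by
    rw [← one_div_le_one_div hs0 one_pos, hsinv, hp'inv, one_div_one]
    have := one_div_le_one_div_of_le hp0 hpq
    linarith
  have hs2 : 1 - 1 / n ≤ 1 / s := by
    rw [hsinv, hp'inv]
    have h1 : n * (1 / p - 1 / q) ≤ 1 := by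
      have : n * (1 / p - 1 / q) = -(n * (1 / q - 1 / p)) := by ring
      linarith
    have h2 : 1 / p - 1 / q ≤ 1 / n := by
      rw [le_div_iff₀ (by linarith)]
      linarith
    linarith
  obtain ⟨C, hC, HC⟩ := exists_integral_weighted_rpow_le (E := E) hE hs1 hs2
  set β : ℝ := κ * r - n with hβ
  set c : ℝ := min n (n + β)
  have hc0 : 0 < c := lt_min (by linarith) (by rw [hβ]; nlinarith)
  set D : ℝ := r / c + r + |β + 1| * (r / c) with hD
  have hD0 : 0 < D := by positivity
  refine ⟨(C * D ^ s) ^ (1 / s), by positivity, fun ε hε f hf h2f ↦ ?_⟩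
  have hw : ∀ x : E, 0 < regNorm ε x := regNorm_pos hε
  set T := ∫ x, regNorm ε x ^ (β + 1) * ‖f x‖ ^ (r - 1) * ‖fderiv ℝ f x‖
  set Y := ∫ x, regNorm ε x ^ (b * q) * ‖f x‖ ^ q
  set A := ∫ x, regNorm ε x ^ (a * p) * ‖fderiv ℝ f x‖ ^ p
  have hT0 : 0 ≤ T := integral_nonneg fun x ↦ by have := hw x; positivity
  have hY0 : 0 ≤ Y := integral_nonneg fun x ↦ by have := hw x; positivity
  have hA0 : 0 ≤ A := integral_nonneg fun x ↦ by have := hw x; positivity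
  have hHardy : ∫ x, regNorm ε x ^ β * ‖f x‖ ^ r ≤ r / c * T := by
    have := min_finrank_mul_integral_regNorm_rpow_le hε β hf h2f hr
    rw [div_mul_eq_mul_div, le_div_iff₀ hc0]
    linarith
  have hGrad := integral_norm_fderiv_regNorm_rpow_mul_norm_rpow_le hε β hf h2f hr
  have hHolder : T ≤ Y ^ (1 / p') * A ^ (1 / p) := by
    have hcf : Continuous fun x ↦ regNorm ε x ^ (b * q / p') * ‖f x‖ ^ (q / p') :=
      (continuous_regNorm_rpow hε _).mul
        (hf.continuous.norm.rpow_const fun _ ↦ Or.inr (by positivity))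
    have hcg : Continuous fun x ↦ regNorm ε x ^ a * ‖fderiv ℝ f x‖ :=
      (continuous_regNorm_rpow hε _).mul (hf.continuous_fderiv one_ne_zero).norm
    have := integral_mul_le_Lp_mul_Lq_of_nonneg (μ := (volume : Measure E)) hpp'.symm
      (f := fun x ↦ regNorm ε x ^ (b * q / p') * ‖f x‖ ^ (q / p'))
      (g := fun x ↦ regNorm ε x ^ a * ‖fderiv ℝ f x‖)
      (ae_of_all _ fun x ↦ by have := hw x; positivity)
      (ae_of_all _ fun x ↦ by have := hw x; positivity)
      (hcf.memLp_of_hasCompactSupport (h2f.norm_rpow (by positivity)).mul_left)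
      (hcg.memLp_of_hasCompactSupport ((h2f.fderiv ℝ).norm).mul_left)
    have e1 : ∀ x, regNorm ε x ^ (b * q / p') * ‖f x‖ ^ (q / p') *
        (regNorm ε x ^ a * ‖fderiv ℝ f x‖) =
        regNorm ε x ^ (β + 1) * ‖f x‖ ^ (r - 1) * ‖fderiv ℝ f x‖ := fun x ↦ by
      have hexp : β + 1 = b * q / p' + a := by
        have h1 : b * q = κ * q - n := by rw [hκ]; field_simp; ring
        have h2 : n / p' = n - n / p := by
          rw [div_eq_mul_one_div, hp'inv]; ring
        rw [h1, sub_div, h2, hβ, hrdef]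
        linear_combination hκa
      rw [hexp, Real.rpow_add (hw x), show r - 1 = q / p' by rw [hrdef]; ring]
      ring
    have e2 : ∀ x, (regNorm ε x ^ (b * q / p') * ‖f x‖ ^ (q / p')) ^ p' =
        regNorm ε x ^ (b * q) * ‖f x‖ ^ q := fun x ↦ by
      have := hw x
      rw [Real.mul_rpow (by positivity) (by positivity), ← Real.rpow_mul this.le,
        ← Real.rpow_mul (norm_nonneg _), div_mul_cancel₀ _ hp'0.ne', div_mul_cancel₀ _ hp'0.ne']
    have e3 : ∀ x, (regNorm ε x ^ a * ‖fderiv ℝ f x‖) ^ p =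
        regNorm ε x ^ (a * p) * ‖fderiv ℝ f x‖ ^ p := fun x ↦ by
      have := hw x
      rw [Real.mul_rpow (by positivity) (by positivity), ← Real.rpow_mul this.le]
    simp_rw [e1, e2, e3] at this
    exact this
  set K := D * (Y ^ (1 / p') * A ^ (1 / p)) with hK
  have hTK : D * T ≤ K := by rw [hK]; gcongr
  have hmain : Y ≤ C * K ^ s := by
    have hK1 : ∫ x, regNorm ε x ^ (-1 : ℝ) * (regNorm ε x ^ (β + 1) * ‖f x‖ ^ r) ≤ K := by
      have e : ∀ x : E, regNorm ε x ^ (-1 : ℝ) * (regNorm ε x ^ (β + 1) * ‖f x‖ ^ r) =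
          regNorm ε x ^ β * ‖f x‖ ^ r := fun x ↦ by
        rw [← mul_assoc, ← Real.rpow_add (hw x)]
        ring_nf
      simp_rw [e]
      refine (hHardy.trans ?_).trans hTK
      gcongr
      rw [hD]
      have : 0 ≤ |β + 1| * (r / c) := by positivity
      linarith
    have hK2 : ∫ x, ‖fderiv ℝ (fun x ↦ regNorm ε x ^ (β + 1) * ‖f x‖ ^ r) x‖ ≤ K := by
      refine (hGrad.trans ?_).trans hTK
      calc _ ≤ r * T + |β + 1| * (r / c * T) := by gcongr
        _ = (r + |β + 1| * (r / c)) * T := by ring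
        _ ≤ D * T := by
          gcongr
          rw [hD]
          have : 0 ≤ r / c := by positivity
          linarith
    have := HC (regNorm ε) (fun x ↦ regNorm ε x ^ (β + 1) * ‖f x‖ ^ r) (continuous_regNorm ε) hw
      (contDiff_regNorm_rpow_mul_norm_rpow hε _ hf hr) (h2f.norm_rpow hr0).mul_left
      (fun x ↦ by have := hw x; positivity) K (by positivity) hK1 hK2
    refine le_of_eq_of_le (integral_congr_ae (ae_of_all _ fun x ↦ ?_)) this
    have hwx := hw x
    change _ = (regNorm ε x ^ (n - 1) * _) ^ s * regNorm ε x ^ (-n)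
    rw [← mul_assoc, ← Real.rpow_add hwx, Real.mul_rpow (by positivity) (by positivity),
      ← Real.rpow_mul hwx.le, ← Real.rpow_mul (norm_nonneg _), mul_right_comm,
      ← Real.rpow_add hwx, hs, mul_div_cancel₀ _ hr0.ne']
    have hexp : (n - 1 + (β + 1)) * (q / r) + -n = b * q := by
      rw [show n - 1 + (β + 1) = κ * r by rw [hβ]; ring, mul_assoc, mul_div_cancel₀ _ hr0.ne',
        hκ, add_mul, div_mul_cancel₀ _ hq0.ne']
      ring
    rw [hexp]
  rcases hY0.eq_or_lt with hY | hY
  · rw [← hY, Real.zero_rpow (by positivity)]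
    positivity
  have hsq : 1 / s = 1 / p' + 1 / q := by rw [hsinv]; ring
  have h1 : Y ^ (1 / s) ≤ (C * D ^ s) ^ (1 / s) * (Y ^ (1 / p') * A ^ (1 / p)) := by
    calc Y ^ (1 / s) ≤ (C * K ^ s) ^ (1 / s) := by gcongr
      _ = _ := by
        rw [hK, Real.mul_rpow hD0.le (by positivity), ← mul_assoc,
          Real.mul_rpow (by positivity) (by positivity), one_div s,
          Real.rpow_rpow_inv (x := Y ^ (1 / p') * A ^ (1 / p)) (by positivity) hs0.ne']
  rw [hsq, Real.rpow_add hY, mul_left_comm] at h1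
  rw [← hsq] at h1
  exact le_of_mul_le_mul_left h1 (by positivity)

/-- Removing the regularization of the weight. -/
lemma tendsto_integral_regNorm_rpow_mul {γ : ℝ} (hE : 1 ≤ Module.finrank ℝ E)
    (hγ : -(Module.finrank ℝ E : ℝ) < γ) {φ : E → ℝ} (hφ : Continuous φ)
    (h2φ : HasCompactSupport φ) :
    Filter.Tendsto (fun ε ↦ ∫ x, regNorm ε x ^ γ * φ x) (nhdsWithin 0 {0}ᶜ)
      (nhds (∫ x, ‖x‖ ^ γ * φ x)) := by
  have : Nontrivial E := Module.nontrivial_of_finrank_pos (R := ℝ) (by omega)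
  have hloc : LocallyIntegrable (fun x : E ↦ ‖x‖ ^ γ) :=
    locallyIntegrable_of_norm_le_rpow (C := 1) (α := -γ) hE (by linarith)
      (ae_of_all _ fun x ↦ by
        rw [neg_neg, one_mul, Real.norm_of_nonneg (Real.rpow_nonneg (norm_nonneg x) γ)])
      (measurable_norm.pow_const γ).aestronglyMeasurable
  have hbi : Integrable fun x ↦ ‖x‖ ^ γ * |φ x| + regNorm 1 x ^ γ * |φ x| :=
    (hloc.integrable_smul_right_of_hasCompactSupport hφ.abs (h2φ.comp_left abs_zero)).add
      (integrable_regNorm_rpow_mul one_ne_zero γ hφ.abs (h2φ.comp_left abs_zero))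
  refine tendsto_integral_filter_of_dominated_convergence _ ?_ ?_ hbi ?_
  · filter_upwards [self_mem_nhdsWithin] with ε hε
    exact (integrable_regNorm_rpow_mul hε γ hφ h2φ).aestronglyMeasurable
  · have h1 : ∀ᶠ ε : ℝ in nhdsWithin 0 {0}ᶜ, ε ^ 2 ≤ 1 :=
      nhdsWithin_le_nhds (((continuous_pow 2).tendsto' (0 : ℝ) 0 (by simp)).eventually_le_const
        one_pos)
    filter_upwards [self_mem_nhdsWithin, h1] with ε hε hε1
    filter_upwards [compl_mem_ae_iff.2 (measure_singleton (0 : E))] with x hx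
    have hx0 : 0 < ‖x‖ := norm_pos_iff.2 hx
    have hw := regNorm_pos hε x
    rw [norm_mul, Real.norm_of_nonneg (by positivity), Real.norm_eq_abs, ← add_mul]
    gcongr
    rcases le_total 0 γ with h | h
    · have : regNorm ε x ≤ regNorm 1 x := Real.sqrt_le_sqrt (by linarith)
      exact (Real.rpow_le_rpow hw.le this h).trans (le_add_of_nonneg_left (by positivity))
    · exact (Real.rpow_le_rpow_of_nonpos hx0 (norm_le_regNorm ε x) h).trans
        (le_add_of_nonneg_right (Real.rpow_nonneg (Real.sqrt_nonneg _) _))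
  · filter_upwards [compl_mem_ae_iff.2 (measure_singleton (0 : E))] with x hx
    have hx0 : 0 < ‖x‖ := norm_pos_iff.2 hx
    have h0 : regNorm 0 x = ‖x‖ := by simp [regNorm]
    have hc : Continuous fun ε ↦ regNorm ε x := by unfold regNorm; fun_prop
    refine Filter.Tendsto.mul_const _ (Filter.Tendsto.rpow_const ?_ (Or.inl hx0.ne'))
    exact (hc.tendsto' 0 _ h0).mono_left nhdsWithin_le_nhds

end Integrals

/-- Caffarelli–Kohn–Nirenberg weighted interpolation inequality (special case):
`‖|x|^b f‖_{L^q} ≤ C ‖|x|^a ∇f‖_{L^p}`. -/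
theorem ckn_weighted_interpolation (n : ℕ) (hn : 1 ≤ n) (p q a b : ℝ)
    (hp : 1 < p) (hpq : p ≤ q)
    (hb : -((n : ℝ) / q) < b) (hba : b ≤ a) (ha : a < (n : ℝ) * (1 - 1 / p))
    (hrel : a - b - 1 = (n : ℝ) * (1 / q - 1 / p)) :
    ∃ C : ℝ, 0 < C ∧ ∀ f : EuclideanSpace ℝ (Fin n) → ℂ,
      ContDiff ℝ (⊤ : ℕ∞) f → HasCompactSupport f →
      (∫ x, ‖x‖ ^ (b * q) * ‖f x‖ ^ q) ^ (1 / q)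
        ≤ C * (∫ x, ‖x‖ ^ (a * p) * ‖fderiv ℝ f x‖ ^ p) ^ (1 / p) := by
  have hdim : Module.finrank ℝ (EuclideanSpace ℝ (Fin n)) = n := by simp
  have hp0 : 0 < p := by linarith
  have hq0 : 0 < q := by linarith
  have hn0 : (0 : ℝ) < n := by exact_mod_cast hn
  obtain ⟨C, hC, H⟩ := exists_regNorm_weighted_interpolation (E := EuclideanSpace ℝ (Fin n))
    (F := ℂ) (by rw [hdim]; exact hn) hp hpq (by rwa [hdim]) hba (by rwa [hdim])
  refine ⟨C, hC, fun f hf h2f ↦ ?_⟩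
  have hf1 : ContDiff ℝ 1 f := hf.of_le (by exact_mod_cast le_top)
  have hbq : -(n : ℝ) < b * q := by
    rw [← neg_div, div_lt_iff₀ hq0] at hb
    exact hb
  have hap : -(n : ℝ) < a * p := by
    have h1 : (n : ℝ) / q ≤ n / p := by gcongr
    have h2 : -(n : ℝ) / p < a := by
      rw [neg_div]
      linarith
    rwa [div_lt_iff₀ hp0] at h2
  have hL := tendsto_integral_regNorm_rpow_mul (E := EuclideanSpace ℝ (Fin n)) (γ := b * q)
    (φ := fun x ↦ ‖f x‖ ^ q) (by rw [hdim]; exact hn) (by rwa [hdim])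
    (hf.continuous.norm.rpow_const fun _ ↦ Or.inr hq0.le) (h2f.norm_rpow hq0)
  have hR := tendsto_integral_regNorm_rpow_mul (E := EuclideanSpace ℝ (Fin n)) (γ := a * p)
    (φ := fun x ↦ ‖fderiv ℝ f x‖ ^ p) (by rw [hdim]; exact hn) (by rwa [hdim])
    ((hf1.continuous_fderiv one_ne_zero).norm.rpow_const fun _ ↦ Or.inr hp0.le)
    ((h2f.fderiv ℝ).norm_rpow hp0)
  refine le_of_tendsto_of_tendsto (hL.rpow_const (Or.inr (by positivity)))
    ((hR.rpow_const (Or.inr (by positivity))).const_mul C) ?_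
  filter_upwards [self_mem_nhdsWithin] with ε hε
  exact H ε hε f hf1 h2f
end

section
/- (Compactness of the weighted Sobolev embedding H¹(ℝⁿ) ↪↪ L^r(|x|^{−τ}dx).) Let n ≥ 3, 0 < τ < 2 and 2 < r < 2(n−τ)/(n−2). Then for every M > 0 and every sequence (u_k) of functions in C_c^∞(ℝⁿ, ℂ) satisfying ∫_{ℝⁿ} (|∇u_k|² + |u_k|²) dx ≤ M for all k, there exists a subsequence (u_{k_j}) that is Cauchy in the weighted norm, i.e. ∫_{ℝⁿ} |x|^{−τ} |u_{k_i} − u_{k_j}|^r dx → 0 as i, j → ∞. -/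
open MeasureTheory Filter

open scoped ENNReal NNReal Topology

/-- Jensen's inequality for the square of a lower Lebesgue integral. -/
theorem sq_lintegral_le_lintegral_sq {α : Type*} [MeasurableSpace α] {ν : Measure α}
    [IsProbabilityMeasure ν] {f : α → ℝ≥0∞} (hf : AEMeasurable f ν) :
    (∫⁻ a, f a ∂ν) ^ 2 ≤ ∫⁻ a, f a ^ 2 ∂ν := by
  have h := ENNReal.lintegral_mul_le_Lp_mul_Lq ν Real.HolderConjugate.two_two hf
    (aemeasurable_const (b := (1 : ℝ≥0∞)))
  simp only [Pi.mul_apply, mul_one, ENNReal.one_rpow, lintegral_one, measure_univ] at h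
  calc (∫⁻ a, f a ∂ν) ^ 2 ≤ ((∫⁻ a, f a ^ (2 : ℝ) ∂ν) ^ (1 / 2 : ℝ)) ^ 2 := by gcongr
    _ = ∫⁻ a, f a ^ 2 ∂ν := by
      rw [← ENNReal.rpow_natCast, ← ENNReal.rpow_mul]
      norm_num

section Mollification

variable {E : Type*} [NormedAddCommGroup E] [NormedSpace ℝ E] [FiniteDimensional ℝ E]
  [MeasurableSpace E] [BorelSpace E] {μ : Measure E} [μ.IsAddHaarMeasure]

/-- The `L²` modulus of continuity under translation is controlled by the gradient. -/
theorem lintegral_enorm_translate_sub_sq_le {v : E → ℂ} (hv : ContDiff ℝ 1 v) (y : E) :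
    ∫⁻ x, ‖v (x + y) - v x‖ₑ ^ 2 ∂μ ≤ ‖y‖ₑ ^ 2 * ∫⁻ x, ‖fderiv ℝ v x‖ₑ ^ 2 ∂μ := by
  have hc : Continuous (fderiv ℝ v) := hv.continuous_fderiv one_ne_zero
  have : IsProbabilityMeasure (volume.restrict (Set.Ioc (0 : ℝ) 1)) := ⟨by simp⟩
  have hpt (x : E) : ‖v (x + y) - v x‖ₑ ^ 2 ≤
      ∫⁻ t in Set.Ioc (0 : ℝ) 1, ‖y‖ₑ ^ 2 * ‖fderiv ℝ v (x + t • y)‖ₑ ^ 2 := by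
    have hd : ∀ t ∈ Set.uIcc (0 : ℝ) 1,
        HasDerivAt (fun t : ℝ => v (x + t • y)) (fderiv ℝ v (x + t • y) y) t := fun t _ => by
      have h2 : HasDerivAt (fun t : ℝ => x + t • y) y t := by
        simpa using ((hasDerivAt_id t).smul_const y).const_add x
      exact ((hv.differentiable one_ne_zero) _).hasFDerivAt.comp_hasDerivAt t h2
    have hcont : Continuous fun t : ℝ => fderiv ℝ v (x + t • y) y := by fun_prop
    have h1 := intervalIntegral.integral_eq_sub_of_hasDerivAt hd
      (hcont.intervalIntegrable 0 1)
    simp only [one_smul, zero_smul, add_zero] at h1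
    rw [← h1, intervalIntegral.integral_of_le zero_le_one]
    calc _ ≤ (∫⁻ t in Set.Ioc (0 : ℝ) 1, ‖fderiv ℝ v (x + t • y) y‖ₑ) ^ 2 := by
          gcongr; exact enorm_integral_le_lintegral_enorm _
      _ ≤ ∫⁻ t in Set.Ioc (0 : ℝ) 1, ‖fderiv ℝ v (x + t • y) y‖ₑ ^ 2 :=
          sq_lintegral_le_lintegral_sq hcont.enorm.aemeasurable
      _ ≤ _ := by
          gcongr with t
          rw [← mul_pow, mul_comm]
          gcongr
          exact ContinuousLinearMap.le_opENorm _ _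
  calc _ ≤ ∫⁻ x, (∫⁻ t in Set.Ioc (0 : ℝ) 1, ‖y‖ₑ ^ 2 * ‖fderiv ℝ v (x + t • y)‖ₑ ^ 2) ∂μ :=
        lintegral_mono hpt
    _ = ∫⁻ t in Set.Ioc (0 : ℝ) 1, (∫⁻ x, ‖y‖ₑ ^ 2 * ‖fderiv ℝ v (x + t • y)‖ₑ ^ 2 ∂μ) := by
        refine lintegral_lintegral_swap (Continuous.aemeasurable ?_)
        exact (ENNReal.continuous_const_mul (by finiteness)).comp
          ((ENNReal.continuous_pow 2).comp (by fun_prop))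
    _ = ∫⁻ t in Set.Ioc (0 : ℝ) 1, (‖y‖ₑ ^ 2 * ∫⁻ x, ‖fderiv ℝ v x‖ₑ ^ 2 ∂μ) := by
        congr with t
        rw [lintegral_const_mul' _ _ (by finiteness),
          lintegral_add_right_eq_self (fun x => ‖fderiv ℝ v x‖ₑ ^ 2)]
    _ = _ := by simp

/-- The `L²` distance of a function to its average with respect to a probability measure supported
in a small ball is controlled by the gradient. -/
theorem lintegral_enorm_sub_average_translate_sq_le {v : E → ℂ} (hv : ContDiff ℝ 1 v)
    (hvs : HasCompactSupport v) {ν : Measure E} [IsProbabilityMeasure ν] {δ : ℝ≥0∞}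
    (hν : ∀ᵐ y ∂ν, ‖y‖ₑ ≤ δ) :
    ∫⁻ x, ‖v x - ∫ y, v (x + y) ∂ν‖ₑ ^ 2 ∂μ ≤ δ ^ 2 * ∫⁻ x, ‖fderiv ℝ v x‖ₑ ^ 2 ∂μ := by
  have hc : Continuous v := hv.continuous
  obtain ⟨C, hC⟩ := hvs.exists_bound_of_continuous hc
  have hpt (x : E) : ‖v x - ∫ y, v (x + y) ∂ν‖ₑ ^ 2 ≤ ∫⁻ y, ‖v (x + y) - v x‖ₑ ^ 2 ∂ν := by
    have hi : Integrable (fun y => v (x + y)) ν :=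
      .of_bound (by fun_prop) C (.of_forall fun y => hC _)
    rw [← enorm_neg, neg_sub]
    have : (∫ y, v (x + y) ∂ν) - v x = ∫ y, (v (x + y) - v x) ∂ν := by
      rw [integral_sub hi (integrable_const _)]; simp
    rw [this]
    calc _ ≤ (∫⁻ y, ‖v (x + y) - v x‖ₑ ∂ν) ^ 2 := by
          gcongr; exact enorm_integral_le_lintegral_enorm _
      _ ≤ _ := sq_lintegral_le_lintegral_sq (Continuous.aemeasurable (by fun_prop))
  calc _ ≤ ∫⁻ x, ∫⁻ y, ‖v (x + y) - v x‖ₑ ^ 2 ∂ν ∂μ := lintegral_mono hpt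
    _ = ∫⁻ y, ∫⁻ x, ‖v (x + y) - v x‖ₑ ^ 2 ∂μ ∂ν :=
        lintegral_lintegral_swap (Continuous.aemeasurable
          ((ENNReal.continuous_pow 2).comp (by fun_prop)))
    _ ≤ ∫⁻ y, δ ^ 2 * ∫⁻ x, ‖fderiv ℝ v x‖ₑ ^ 2 ∂μ ∂ν := by
        refine lintegral_mono_ae ?_
        filter_upwards [hν] with y hy
        exact (lintegral_enorm_translate_sub_sq_le hv y).trans (by gcongr)
    _ = _ := by simp

end Mollification

/-- A bounded sequence in `L²` has a subsequence whose integrals over every set of finite measure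
converge. -/
theorem exists_subseq_tendsto_setIntegral {α : Type*} [MeasurableSpace α] {μ : Measure α}
    [IsSeparable μ] {f : ℕ → α → ℂ} (hf : ∀ k, MemLp (f k) 2 μ) {K : ℝ}
    (hK : ∀ k, eLpNorm (f k) 2 μ ≤ ENNReal.ofReal K) :
    ∃ φ : ℕ → ℕ, StrictMono φ ∧ ∀ s, MeasurableSet s → μ s ≠ ∞ →
      ∃ l, Tendsto (fun k => ∫ x in s, f (φ k) x ∂μ) atTop (𝓝 l) := by
  have : Fact ((2 : ℝ≥0∞) ≠ ∞) := ⟨by simp⟩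
  let U (k : ℕ) : Lp ℂ 2 μ := (hf k).toLp (f k)
  let T (k : ℕ) : WeakDual ℂ (Lp ℂ 2 μ) := StrongDual.toWeakDual (innerSL ℂ (U k))
  have hT (k : ℕ) : T k ∈ WeakDual.toStrongDual ⁻¹' Metric.closedBall
      (0 : StrongDual ℂ (Lp ℂ 2 μ)) (max K 0) := by
    have : ‖U k‖ ≤ max K 0 := by
      rw [Lp.norm_toLp]
      refine (ENNReal.toReal_mono ENNReal.ofReal_ne_top (hK k)).trans ?_
      rw [ENNReal.toReal_ofReal']
    simpa [T] using this
  obtain ⟨L, -, φ, hφ, hL⟩ := WeakDual.isSeqCompact_closedBall ℂ (Lp ℂ 2 μ) 0 (max K 0) hT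
  refine ⟨φ, hφ, fun s hs hμs => ?_⟩
  let g : Lp ℂ 2 μ := indicatorConstLp 2 hs hμs (1 : ℂ)
  refine ⟨star (L g), ?_⟩
  have h1 : Tendsto (fun k => T (φ k) g) atTop (𝓝 (L g)) :=
    ((WeakDual.eval_continuous g).tendsto L).comp hL
  refine (h1.star).congr fun k => ?_
  have h2 : T (φ k) g = inner ℂ (U (φ k)) g := rfl
  have h3 : inner ℂ g (U (φ k)) = ∫ x in s, U (φ k) x ∂μ :=
    L2.inner_indicatorConstLp_one hs hμs (U (φ k))
  have h4 : star (inner ℂ (U (φ k)) g : ℂ) = inner ℂ g (U (φ k)) := inner_conj_symm _ _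
  rw [h2, h4, h3]
  exact integral_congr_ae (ae_restrict_of_ae (hf (φ k)).coeFn_toLp)

theorem enorm_sub_sq_le {F : Type*} [SeminormedAddCommGroup F] (a b : F) :
    ‖a - b‖ₑ ^ 2 ≤ 2 * (‖a‖ₑ ^ 2 + ‖b‖ₑ ^ 2) := by
  have h := ENNReal.rpow_add_le_mul_rpow_add_rpow ‖a‖ₑ ‖b‖ₑ (p := 2) one_le_two
  norm_num at h
  exact (pow_le_pow_left' enorm_sub_le 2).trans h

theorem enorm_add_sq_le {F : Type*} [SeminormedAddCommGroup F] (a b : F) :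
    ‖a + b‖ₑ ^ 2 ≤ 2 * (‖a‖ₑ ^ 2 + ‖b‖ₑ ^ 2) := by
  simpa using enorm_sub_sq_le a (-b)

/-- If the `L²` norms of two functions are bounded, so is that of their difference. -/
theorem lintegral_enorm_sub_sq_le {α F : Type*} [MeasurableSpace α] {μ : Measure α}
    [NormedAddCommGroup F] {f g : α → F} (hf : AEStronglyMeasurable f μ)
    {K : ℝ≥0∞} (hfK : ∫⁻ x, ‖f x‖ₑ ^ 2 ∂μ ≤ K) (hgK : ∫⁻ x, ‖g x‖ₑ ^ 2 ∂μ ≤ K) :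
    ∫⁻ x, ‖f x - g x‖ₑ ^ 2 ∂μ ≤ 4 * K := by
  calc _ ≤ ∫⁻ x, 2 * (‖f x‖ₑ ^ 2 + ‖g x‖ₑ ^ 2) ∂μ := lintegral_mono fun x => enorm_sub_sq_le _ _
    _ = 2 * (∫⁻ x, ‖f x‖ₑ ^ 2 ∂μ + ∫⁻ x, ‖g x‖ₑ ^ 2 ∂μ) := by
      rw [lintegral_const_mul' _ _ (by finiteness), lintegral_add_left' (by fun_prop)]
    _ ≤ 2 * (K + K) := by gcongr
    _ = 4 * K := by ring

/-- Local Rellich–Kondrachov compactness: an `H¹`-bounded sequence of compactly supported `C¹`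
functions has a subsequence that is Cauchy in `L²` of every set of finite measure. -/
theorem exists_subseq_tendsto_setLIntegral_enorm_sub_sq {E : Type*} [NormedAddCommGroup E]
    [NormedSpace ℝ E] [FiniteDimensional ℝ E] [MeasurableSpace E] [BorelSpace E] {μ : Measure E}
    [μ.IsAddHaarMeasure] {u : ℕ → E → ℂ} (hu : ∀ k, ContDiff ℝ 1 (u k))
    (hus : ∀ k, HasCompactSupport (u k)) {K : ℝ≥0}
    (huK : ∀ k, ∫⁻ x, ‖u k x‖ₑ ^ 2 ∂μ ≤ K) (hdK : ∀ k, ∫⁻ x, ‖fderiv ℝ (u k) x‖ₑ ^ 2 ∂μ ≤ K) :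
    ∃ φ : ℕ → ℕ, StrictMono φ ∧ ∀ s, μ s ≠ ∞ →
      Tendsto (fun ij : ℕ × ℕ => ∫⁻ x in s, ‖u (φ ij.1) x - u (φ ij.2) x‖ₑ ^ 2 ∂μ)
        atTop (𝓝 0) := by
  have hcu (k : ℕ) : Continuous (u k) := (hu k).continuous
  have hLp (k : ℕ) : MemLp (u k) 2 μ := (hcu k).memLp_of_hasCompactSupport (hus k)
  have hLpK (k : ℕ) : eLpNorm (u k) 2 μ ≤ ENNReal.ofReal ((K : ℝ) ^ (1 / 2 : ℝ)) := by
    rw [eLpNorm_eq_lintegral_rpow_enorm_toReal (by simp) (by simp),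
      ← ENNReal.ofReal_rpow_of_nonneg (p := 1 / 2) K.coe_nonneg (by norm_num)]
    simp only [ENNReal.toReal_ofNat, ENNReal.rpow_ofNat, ENNReal.ofReal_coe_nnreal]
    gcongr
    exact huK k
  obtain ⟨φ, hφ, hlim⟩ := exists_subseq_tendsto_setIntegral hLp hLpK
  refine ⟨φ, hφ, fun s hs => ?_⟩
  let v (ij : ℕ × ℕ) (x : E) : ℂ := u (φ ij.1) x - u (φ ij.2) x
  have hv (ij) : ContDiff ℝ 1 (v ij) := (hu _).sub (hu _)
  have hvs (ij) : HasCompactSupport (v ij) := (hus _).sub (hus _)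
  have hvK (ij) : ∫⁻ x, ‖v ij x‖ₑ ^ 2 ∂μ ≤ 4 * K :=
    lintegral_enorm_sub_sq_le (hcu _).aestronglyMeasurable (huK _) (huK _)
  have hdvK (ij) : ∫⁻ x, ‖fderiv ℝ (v ij) x‖ₑ ^ 2 ∂μ ≤ 4 * K := by
    have : fderiv ℝ (v ij) = fun x => fderiv ℝ (u (φ ij.1)) x - fderiv ℝ (u (φ ij.2)) x := by
      ext1 x
      exact fderiv_fun_sub ((hu _).differentiable one_ne_zero _)
        ((hu _).differentiable one_ne_zero _)
    rw [this]
    exact lintegral_enorm_sub_sq_le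
      ((hu _).continuous_fderiv one_ne_zero).aestronglyMeasurable (hdK _) (hdK _)
  -- averages over small balls converge in `L²(s)`
  have havg (δ : ℝ) (hδ : 0 < δ) : Tendsto (fun ij : ℕ × ℕ =>
      ∫⁻ x in s, ‖∫ y, v ij (x + y) ∂(ProbabilityTheory.cond μ (Metric.ball 0 δ))‖ₑ ^ 2 ∂μ)
      atTop (𝓝 0) := by
    set B : Set E := Metric.ball 0 δ with hB
    have hB0 : μ B ≠ 0 := (Metric.measure_ball_pos μ 0 hδ).ne'
    have hBt : μ B ≠ ∞ := measure_ball_lt_top.ne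
    have : IsProbabilityMeasure (ProbabilityTheory.cond μ B) :=
      ProbabilityTheory.cond_isProbabilityMeasure_of_finite hB0 hBt
    have hsplit (ij : ℕ × ℕ) (x : E) : ∫ y, v ij (x + y) ∂(ProbabilityTheory.cond μ B) =
        (μ B).toReal⁻¹ • ((∫ z in Metric.ball x δ, u (φ ij.1) z ∂μ) -
          ∫ z in Metric.ball x δ, u (φ ij.2) z ∂μ) := by
      have hpre : B = (fun y => x + y) ⁻¹' Metric.ball x δ := by
        ext y; simp [hB]
      rw [ProbabilityTheory.cond, integral_smul_measure, ENNReal.toReal_inv,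
        ← integral_sub ((hcu _).integrable_of_hasCompactSupport (hus _)).integrableOn
          ((hcu _).integrable_of_hasCompactSupport (hus _)).integrableOn]
      congr 1
      rw [hpre]
      exact (measurePreserving_add_left μ x).setIntegral_preimage_emb
        (measurableEmbedding_addLeft x) (v ij) _
    have hlim' (x : E) : Tendsto (fun ij : ℕ × ℕ =>
        ‖∫ y, v ij (x + y) ∂(ProbabilityTheory.cond μ B)‖ₑ ^ 2) atTop (𝓝 0) := by
      obtain ⟨l, hl⟩ := hlim (Metric.ball x δ) measurableSet_ball measure_ball_lt_top.ne
      have h := ((hl.comp tendsto_fst).sub (hl.comp tendsto_snd)).const_smul (μ B).toReal⁻¹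
      rw [prod_atTop_atTop_eq, sub_self, smul_zero] at h
      have h2 := ((ENNReal.continuous_pow 2).comp continuous_enorm).tendsto (0 : ℂ) |>.comp h
      simp only [Function.comp_apply, enorm_zero, ne_eq, OfNat.ofNat_ne_zero, not_false_eq_true,
        zero_pow] at h2
      exact h2.congr fun ij => by simp [hsplit]
    have hbd (ij : ℕ × ℕ) (x : E) : ‖∫ y, v ij (x + y) ∂(ProbabilityTheory.cond μ B)‖ₑ ^ 2 ≤
        (μ B)⁻¹ * (4 * K) := by
      have hcv := (hv ij).continuous
      calc _ ≤ (∫⁻ y, ‖v ij (x + y)‖ₑ ∂(ProbabilityTheory.cond μ B)) ^ 2 := by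
            gcongr; exact enorm_integral_le_lintegral_enorm _
        _ ≤ ∫⁻ y, ‖v ij (x + y)‖ₑ ^ 2 ∂(ProbabilityTheory.cond μ B) :=
            sq_lintegral_le_lintegral_sq (Continuous.aemeasurable (by fun_prop))
        _ = (μ B)⁻¹ * ∫⁻ y in B, ‖v ij (x + y)‖ₑ ^ 2 ∂μ := by
            rw [ProbabilityTheory.cond, lintegral_smul_measure, smul_eq_mul]
        _ ≤ (μ B)⁻¹ * ∫⁻ y, ‖v ij (x + y)‖ₑ ^ 2 ∂μ := by
            gcongr; exact Measure.restrict_le_self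
        _ ≤ _ := by
            rw [lintegral_add_left_eq_self (fun z => ‖v ij z‖ₑ ^ 2)]
            gcongr
            exact hvK ij
    have h := tendsto_lintegral_filter_of_dominated_convergence (μ := μ.restrict s)
      (l := (atTop : Filter (ℕ × ℕ))) (f := fun _ => 0)
      (F := fun ij x => ‖∫ y, v ij (x + y) ∂(ProbabilityTheory.cond μ B)‖ₑ ^ 2)
      (fun _ => (μ B)⁻¹ * (4 * K)) (.of_forall fun ij => ?_)
      (.of_forall fun ij => .of_forall (hbd ij)) ?_ (.of_forall hlim')
    · simpa using h
    · have hcv := (hv ij).continuous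
      have : StronglyMeasurable (fun p : E × E => v ij (p.1 + p.2)) :=
        Continuous.stronglyMeasurable (by fun_prop)
      exact this.integral_prod_right.enorm.pow_const 2
    · simp only [lintegral_const, Measure.restrict_apply_univ]
      finiteness
  rw [ENNReal.tendsto_nhds_zero]
  intro ε hε
  obtain ⟨δ, hδ, hδε⟩ : ∃ δ : ℝ, 0 < δ ∧ ENNReal.ofReal δ ^ 2 * (4 * K) ≤ ε / 4 := by
    have h : Tendsto (fun δ : ℝ => ENNReal.ofReal δ ^ 2 * (4 * K : ℝ≥0∞)) (𝓝[>] 0) (𝓝 0) := by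
      have h1 : Continuous fun δ : ℝ => ENNReal.ofReal δ ^ 2 * (4 * K : ℝ≥0∞) :=
        (ENNReal.continuous_mul_const (by finiteness)).comp
          ((ENNReal.continuous_pow 2).comp ENNReal.continuous_ofReal)
      simpa using (h1.tendsto 0).mono_left nhdsWithin_le_nhds
    obtain ⟨δ, h1, h2⟩ := ((ENNReal.tendsto_nhds_zero.1 h (ε / 4)
      (ENNReal.div_pos hε.ne' (by simp))).and self_mem_nhdsWithin).exists
    exact ⟨δ, h2, h1⟩
  filter_upwards [ENNReal.tendsto_nhds_zero.1 (havg δ hδ) (ε / 4)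
    (ENNReal.div_pos hε.ne' (by simp))] with ij hij
  set ν := ProbabilityTheory.cond μ (Metric.ball (0 : E) δ)
  have : IsProbabilityMeasure ν :=
    ProbabilityTheory.cond_isProbabilityMeasure_of_finite
      (Metric.measure_ball_pos μ 0 hδ).ne' measure_ball_lt_top.ne
  have hsupp : ∀ᵐ y ∂ν, ‖y‖ₑ ≤ ENNReal.ofReal δ := by
    filter_upwards [ProbabilityTheory.ae_cond_mem (μ := μ)
      (measurableSet_ball (x := (0 : E)) (ε := δ))] with y hy
    rw [← ofReal_norm]
    exact ENNReal.ofReal_le_ofReal (mem_ball_zero_iff.1 hy).le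
  have hmeas : Measurable fun x => ‖v ij x - ∫ y, v ij (x + y) ∂ν‖ₑ ^ 2 := by
    have hcv := (hv ij).continuous
    have : StronglyMeasurable (fun p : E × E => v ij (p.1 + p.2)) :=
      Continuous.stronglyMeasurable (by fun_prop)
    exact (hcv.stronglyMeasurable.sub this.integral_prod_right).enorm.pow_const 2
  calc ∫⁻ x in s, ‖v ij x‖ₑ ^ 2 ∂μ
      ≤ ∫⁻ x in s, 2 * (‖v ij x - ∫ y, v ij (x + y) ∂ν‖ₑ ^ 2 +
          ‖∫ y, v ij (x + y) ∂ν‖ₑ ^ 2) ∂μ := by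
        refine lintegral_mono fun x => ?_
        simpa using enorm_add_sq_le (v ij x - ∫ y, v ij (x + y) ∂ν) (∫ y, v ij (x + y) ∂ν)
    _ = 2 * (∫⁻ x in s, ‖v ij x - ∫ y, v ij (x + y) ∂ν‖ₑ ^ 2 ∂μ +
          ∫⁻ x in s, ‖∫ y, v ij (x + y) ∂ν‖ₑ ^ 2 ∂μ) := by
        rw [lintegral_const_mul' _ _ (by finiteness), lintegral_add_left hmeas]
    _ ≤ 2 * (ε / 4 + ε / 4) := by
        gcongr
        calc _ ≤ ∫⁻ x, ‖v ij x - ∫ y, v ij (x + y) ∂ν‖ₑ ^ 2 ∂μ :=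
              lintegral_mono' Measure.restrict_le_self le_rfl
          _ ≤ ENNReal.ofReal δ ^ 2 * ∫⁻ x, ‖fderiv ℝ (v ij) x‖ₑ ^ 2 ∂μ :=
              lintegral_enorm_sub_average_translate_sq_le (hv ij) (hvs ij) hsupp
          _ ≤ ENNReal.ofReal δ ^ 2 * (4 * K) := by gcongr; exact hdvK ij
          _ ≤ ε / 4 := hδε
    _ = ε := by
        rw [← two_mul, ← mul_assoc, show (2 * 2 : ℝ≥0∞) = 4 by norm_num]
        exact ENNReal.mul_div_cancel (by simp) (by simp)

/-- Hölder's inequality for a weight and two powers of the same function. -/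
theorem lintegral_weight_mul_rpow_le {α : Type*} [MeasurableSpace α] {μ : Measure α}
    {w f : α → ℝ≥0∞} (hw : AEMeasurable w μ) (hf : AEMeasurable f μ) {a b c p q r : ℝ}
    (ha : 0 < a) (hb : 0 ≤ b) (hc : 0 ≤ c) (habc : a + b + c = 1) (hp : 0 ≤ p) (hq : 0 ≤ q)
    (hr : p * b + q * c = r) :
    ∫⁻ x, w x * f x ^ r ∂μ ≤
      (∫⁻ x, w x ^ (1 / a) ∂μ) ^ a * (∫⁻ x, f x ^ p ∂μ) ^ b * (∫⁻ x, f x ^ q ∂μ) ^ c := by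
  have h := ENNReal.lintegral_prod_norm_pow_le (μ := μ) Finset.univ
    (f := ![fun x => w x ^ (1 / a), fun x => f x ^ p, fun x => f x ^ q]) (p := ![a, b, c])
    (by
      intro i _
      fin_cases i
      · exact hw.pow_const _
      · exact hf.pow_const _
      · exact hf.pow_const _)
    (by simpa [Fin.sum_univ_three] using habc)
    (by
      intro i _
      fin_cases i
      · exact ha.le
      · exact hb
      · exact hc)
  simp only [Fin.prod_univ_three, Matrix.cons_val] at h
  refine le_of_eq_of_le (lintegral_congr fun x => ?_) h
  rw [← ENNReal.rpow_mul, ← ENNReal.rpow_mul, ← ENNReal.rpow_mul, one_div_mul_cancel ha.ne',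
    ENNReal.rpow_one, mul_assoc, ← ENNReal.rpow_add_of_nonneg _ _ (by positivity) (by positivity),
    hr]

/-- The weight `‖x‖ ^ (-s)` is integrable on balls for `s` below the dimension. -/
theorem setLIntegral_ball_norm_rpow_neg_lt_top {E : Type*} [NormedAddCommGroup E]
    [NormedSpace ℝ E] [FiniteDimensional ℝ E] [MeasurableSpace E] [BorelSpace E] {μ : Measure E}
    [μ.IsAddHaarMeasure] (hd : 1 ≤ Module.finrank ℝ E) {s : ℝ} (hs : s < Module.finrank ℝ E)
    (R : ℝ) : ∫⁻ x in Metric.ball 0 R, ENNReal.ofReal (‖x‖ ^ (-s)) ∂μ < ∞ := by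
  refine (integrableOn_ball_of_norm_le_rpow (C := 1) hd hs (.of_forall fun x => ?_)
    (Measurable.aestronglyMeasurable (by fun_prop))).lintegral_lt_top
  rw [one_mul, Real.norm_of_nonneg (by positivity)]

/-- Away from a ball, the weighted `L^r` integral is controlled by the `L^p` and `L^q` integrals
for `p ≤ r ≤ q`. -/
theorem setLIntegral_compl_ball_norm_rpow_neg_mul_le {E : Type*} [NormedAddCommGroup E]
    [MeasurableSpace E] [OpensMeasurableSpace E] {μ : Measure E} {f : E → ℝ≥0∞}
    (hf : AEMeasurable f μ) {τ p q r R : ℝ} (hτ : 0 ≤ τ) (hpr : p ≤ r) (hrq : r ≤ q)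
    (hR : 0 < R) :
    ∫⁻ x in (Metric.ball 0 R)ᶜ, ENNReal.ofReal (‖x‖ ^ (-τ)) * f x ^ r ∂μ ≤
      ENNReal.ofReal (R ^ (-τ)) * (∫⁻ x, f x ^ p ∂μ + ∫⁻ x, f x ^ q ∂μ) := by
  calc _ ≤ ∫⁻ x in (Metric.ball 0 R)ᶜ, ENNReal.ofReal (R ^ (-τ)) * (f x ^ p + f x ^ q) ∂μ := by
        refine setLIntegral_mono' measurableSet_ball.compl fun x hx => ?_
        have hx' : R ≤ ‖x‖ := by simpa using hx
        gcongr ?_ * ?_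
        · exact ENNReal.ofReal_le_ofReal
            (Real.rpow_le_rpow_of_nonpos hR hx' (neg_nonpos.2 hτ))
        · rcases le_total (f x) 1 with h | h
          · exact (ENNReal.rpow_le_rpow_of_exponent_ge h hpr).trans le_self_add
          · exact (ENNReal.rpow_le_rpow_of_exponent_le h hrq).trans le_add_self
    _ ≤ ∫⁻ x, ENNReal.ofReal (R ^ (-τ)) * (f x ^ p + f x ^ q) ∂μ :=
        lintegral_mono' Measure.restrict_le_self le_rfl
    _ = _ := by
        rw [lintegral_const_mul' _ _ ENNReal.ofReal_ne_top, lintegral_add_left' (hf.pow_const _)]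

/-- Sobolev's inequality as a uniform bound on functions with bounded Dirichlet energy. -/
theorem exists_lintegral_enorm_rpow_le_of_lintegral_fderiv_sq_le {E : Type*}
    [NormedAddCommGroup E] [NormedSpace ℝ E] [FiniteDimensional ℝ E] [MeasurableSpace E]
    [BorelSpace E] {μ : Measure E} [μ.IsAddHaarMeasure] (hd : 0 < Module.finrank ℝ E) {q : ℝ}
    (hq : 0 < q) (hq' : q⁻¹ = 2⁻¹ - (Module.finrank ℝ E : ℝ)⁻¹) (K : ℝ≥0) :
    ∃ K' : ℝ≥0, ∀ v : E → ℂ, ContDiff ℝ 1 v → HasCompactSupport v →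
      ∫⁻ x, ‖fderiv ℝ v x‖ₑ ^ 2 ∂μ ≤ K → ∫⁻ x, ‖v x‖ₑ ^ q ∂μ ≤ K' := by
  lift q to ℝ≥0 using hq.le
  have hq0 : q ≠ 0 := by rintro rfl; simp at hq
  refine ⟨(SNormLESNormFDerivOfEqConst ℂ μ (2 : ℝ≥0) * K ^ (1 / 2 : ℝ)) ^ (q : ℝ),
    fun v hv hvs hK => ?_⟩
  have h := eLpNorm_le_eLpNorm_fderiv_of_eq μ hv hvs one_le_two hd (p' := q) hq'
  have h2 : eLpNorm (fderiv ℝ v) (2 : ℝ≥0) μ ≤ (K : ℝ≥0∞) ^ (1 / 2 : ℝ) := by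
    rw [eLpNorm_nnreal_eq_lintegral two_ne_zero]
    simp only [NNReal.coe_ofNat, ENNReal.rpow_ofNat]
    gcongr
  rw [eLpNorm_nnreal_eq_lintegral hq0] at h
  calc ∫⁻ x, ‖v x‖ₑ ^ (q : ℝ) ∂μ = ((∫⁻ x, ‖v x‖ₑ ^ (q : ℝ) ∂μ) ^ (1 / (q : ℝ))) ^ (q : ℝ) := by
        rw [← ENNReal.rpow_mul, one_div_mul_cancel hq.ne', ENNReal.rpow_one]
    _ ≤ (SNormLESNormFDerivOfEqConst ℂ μ (2 : ℝ≥0) * (K : ℝ≥0∞) ^ (1 / 2 : ℝ)) ^ (q : ℝ) := by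
        gcongr
        exact h.trans (by gcongr)
    _ = _ := by
        rw [ENNReal.coe_rpow_of_nonneg _ hq.le, ENNReal.coe_mul,
          ENNReal.coe_rpow_of_nonneg _ (by norm_num)]

/-- Compactness of the weighted Sobolev embedding `H¹(ℝⁿ) ↪↪ L^r(|x|^{-τ} dx)`:
any `H¹`-bounded sequence of smooth compactly supported functions has a subsequence
that is Cauchy in the weighted `L^r(|x|^{-τ} dx)` norm. -/
theorem compact_weighted_sobolev_embedding (n : ℕ) (hn : 3 ≤ n) (τ r : ℝ)
    (hτ0 : 0 < τ) (hτ2 : τ < 2) (hr2 : 2 < r) (hr : r < 2 * ((n : ℝ) - τ) / ((n : ℝ) - 2))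
    (M : ℝ) (hM : 0 < M) (u : ℕ → EuclideanSpace ℝ (Fin n) → ℂ)
    (husmooth : ∀ k, ContDiff ℝ (⊤ : ℕ∞) (u k)) (husupp : ∀ k, HasCompactSupport (u k))
    (hbdd : ∀ k, (∫ x, (‖fderiv ℝ (u k) x‖ ^ 2 + ‖u k x‖ ^ 2)) ≤ M) :
    ∃ φ : ℕ → ℕ, StrictMono φ ∧
      Tendsto (fun ij : ℕ × ℕ => ∫ x, ‖x‖ ^ (-τ) * ‖u (φ ij.1) x - u (φ ij.2) x‖ ^ r)
        atTop (nhds 0) := by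
  have hn' : (3 : ℝ) ≤ n := by exact_mod_cast hn
  have hu (k) : ContDiff ℝ 1 (u k) := (husmooth k).of_le (by exact_mod_cast le_top)
  have hcu (k) : Continuous (u k) := (hu k).continuous
  have hcd (k) : Continuous (fderiv ℝ (u k)) := (hu k).continuous_fderiv one_ne_zero
  set K : ℝ≥0 := M.toNNReal
  have hH1 (k) : ∫⁻ x, (‖fderiv ℝ (u k) x‖ₑ ^ 2 + ‖u k x‖ₑ ^ 2) ≤ K := by
    have hi : Integrable fun x => ‖fderiv ℝ (u k) x‖ ^ 2 + ‖u k x‖ ^ 2 := by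
      refine Continuous.integrable_of_hasCompactSupport (by fun_prop) ?_
      refine HasCompactSupport.add ?_ ?_
      · exact ((husupp k).fderiv ℝ).norm.comp_left (g := fun t : ℝ => t ^ 2) (by simp)
      · exact (husupp k).norm.comp_left (g := fun t : ℝ => t ^ 2) (by simp)
    have h := ENNReal.ofReal_le_ofReal (hbdd k)
    rw [ofReal_integral_eq_lintegral_ofReal hi (.of_forall fun x => by positivity)] at h
    refine le_of_eq_of_le (lintegral_congr fun x => ?_) h
    rw [ENNReal.ofReal_add (by positivity) (by positivity), ENNReal.ofReal_pow (norm_nonneg _),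
      ENNReal.ofReal_pow (norm_nonneg _), ofReal_norm, ofReal_norm]
  have huK (k) : ∫⁻ x, ‖u k x‖ₑ ^ 2 ≤ K :=
    (lintegral_mono fun x => le_add_self).trans (hH1 k)
  have hdK (k) : ∫⁻ x, ‖fderiv ℝ (u k) x‖ₑ ^ 2 ≤ K :=
    (lintegral_mono fun x => le_self_add).trans (hH1 k)
  obtain ⟨φ, hφ, hloc⟩ := exists_subseq_tendsto_setLIntegral_enorm_sub_sq hu husupp huK hdK
  refine ⟨φ, hφ, ?_⟩
  let v (ij : ℕ × ℕ) (x : EuclideanSpace ℝ (Fin n)) : ℂ := u (φ ij.1) x - u (φ ij.2) x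
  have hv (ij) : ContDiff ℝ 1 (v ij) := (hu _).sub (hu _)
  have hvm (ij) : Measurable (v ij) := (hv ij).continuous.measurable
  have hvK (ij) : ∫⁻ x, ‖v ij x‖ₑ ^ (2 : ℝ) ≤ 4 * K := by
    simp only [ENNReal.rpow_ofNat]
    exact lintegral_enorm_sub_sq_le (hcu _).aestronglyMeasurable (huK _) (huK _)
  have hdvK (ij) : ∫⁻ x, ‖fderiv ℝ (v ij) x‖ₑ ^ 2 ≤ (4 * K : ℝ≥0) := by
    have : fderiv ℝ (v ij) = fun x => fderiv ℝ (u (φ ij.1)) x - fderiv ℝ (u (φ ij.2)) x := by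
      ext1 x
      exact fderiv_fun_sub ((hu _).differentiable one_ne_zero _)
        ((hu _).differentiable one_ne_zero _)
    rw [this]
    push_cast
    exact lintegral_enorm_sub_sq_le (hcd _).aestronglyMeasurable (hdK _) (hdK _)
  -- exponents
  set q : ℝ := 2 * n / (n - 2) with hqdef
  have hn2 : (0 : ℝ) < n - 2 := by linarith
  have hq : 0 < q := by positivity
  have hq' : q⁻¹ = 2⁻¹ - (n : ℝ)⁻¹ := by rw [hqdef]; field_simp
  have hrτ : r * q⁻¹ < 1 - τ / n := by
    rw [lt_div_iff₀ hn2] at hr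
    rw [hqdef, inv_div, ← mul_div_assoc, div_lt_iff₀ (by positivity)]
    have : (1 - τ / n) * (2 * (n : ℝ)) = 2 * (n - τ) := by field_simp
    linarith
  have hrq : r ≤ q := by
    have h1 : r * q⁻¹ ≤ 1 := hrτ.le.trans (by linarith [show 0 ≤ τ / n by positivity])
    rwa [← div_eq_mul_inv, div_le_one hq] at h1
  obtain ⟨K', hK'⟩ := exists_lintegral_enorm_rpow_le_of_lintegral_fderiv_sq_le
    (E := EuclideanSpace ℝ (Fin n)) (μ := volume) (by simp; omega) hq (by simpa using hq') (4 * K)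
  have hvK' (ij) : ∫⁻ x, ‖v ij x‖ₑ ^ q ≤ K' :=
    hK' _ (hv ij) ((husupp _).sub (husupp _)) (hdvK ij)
  obtain ⟨a, b, c, ha, hb, hc, habc, hbc, haτ⟩ : ∃ a b c : ℝ, 0 < a ∧ 0 < b ∧ 0 ≤ c ∧
      a + b + c = 1 ∧ 2 * b + q * c = r ∧ τ / a < n := by
    set b : ℝ := (1 - τ / n - r * q⁻¹) / 2 with hb
    have hτn : 0 < τ / n := by positivity
    have hrq0 : 0 < r * q⁻¹ := by positivity
    have hbq : 0 < b * q⁻¹ := mul_pos (by linarith) (by positivity)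
    have hcq : (r - 2 * b) / q = r * q⁻¹ - 2 * (b * q⁻¹) := by field_simp
    have hlt : τ / n < 1 - b - (r - 2 * b) / q := by rw [hcq]; linarith
    refine ⟨1 - b - (r - 2 * b) / q, b, (r - 2 * b) / q, hτn.trans hlt, by linarith,
      div_nonneg (by linarith) hq.le, by ring, by field_simp; ring, ?_⟩
    rw [div_lt_iff₀ (by positivity)] at hlt
    rw [div_lt_iff₀ (hτn.trans (by rwa [div_lt_iff₀ (by positivity)]))]
    linarith
  -- convergence on balls
  have hball (R : ℝ) : Tendsto (fun ij => ∫⁻ x in Metric.ball 0 R,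
      ENNReal.ofReal (‖x‖ ^ (-τ)) * ‖v ij x‖ₑ ^ r) atTop (𝓝 0) := by
    set W := ∫⁻ x in Metric.ball (0 : EuclideanSpace ℝ (Fin n)) R,
      ENNReal.ofReal (‖x‖ ^ (-τ)) ^ (1 / a)
    have hW : W < ∞ := by
      have h := setLIntegral_ball_norm_rpow_neg_lt_top (E := EuclideanSpace ℝ (Fin n))
        (μ := volume) (by simp; omega) (s := τ / a) (by simpa using haτ) R
      refine lt_of_eq_of_lt (lintegral_congr fun x => ?_) h
      rw [ENNReal.ofReal_rpow_of_nonneg (by positivity) (by positivity),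
        ← Real.rpow_mul (norm_nonneg _)]
      congr 2
      ring
    have hlim : Tendsto (fun ij => W ^ a * (∫⁻ x in Metric.ball 0 R, ‖v ij x‖ₑ ^ (2 : ℝ)) ^ b *
        (K' : ℝ≥0∞) ^ c) atTop (𝓝 0) := by
      have h0 := hloc (Metric.ball 0 R) measure_ball_lt_top.ne
      have h1 := (ENNReal.continuous_rpow_const (y := b)).tendsto 0 |>.comp h0
      have h2 := ENNReal.Tendsto.mul_const (ENNReal.Tendsto.const_mul h1
        (Or.inr (ENNReal.rpow_ne_top_of_nonneg ha.le hW.ne)))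
        (Or.inr (ENNReal.rpow_ne_top_of_nonneg hc (ENNReal.coe_ne_top (r := K'))))
      simpa [ENNReal.zero_rpow_of_pos hb, v] using h2
    refine tendsto_of_tendsto_of_tendsto_of_le_of_le tendsto_const_nhds hlim
      (fun _ => zero_le) fun ij => ?_
    refine (lintegral_weight_mul_rpow_le (by fun_prop) (by fun_prop) ha hb.le hc habc zero_le_two
      hq.le hbc).trans ?_
    gcongr
    exact (lintegral_mono' Measure.restrict_le_self le_rfl).trans (hvK' ij)
  have hmain : Tendsto (fun ij => ∫⁻ x, ENNReal.ofReal (‖x‖ ^ (-τ)) * ‖v ij x‖ₑ ^ r)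
      atTop (𝓝 0) := by
    rw [ENNReal.tendsto_nhds_zero]
    intro ε hε
    have hε2 : 0 < ε / 2 := ENNReal.half_pos hε.ne'
    obtain ⟨R, hR, hRε⟩ : ∃ R : ℝ, 0 < R ∧
        ENNReal.ofReal (R ^ (-τ)) * (4 * K + K') ≤ ε / 2 := by
      have h := ENNReal.Tendsto.mul_const (b := (4 * K + K' : ℝ≥0∞))
        (ENNReal.tendsto_ofReal (tendsto_rpow_neg_atTop hτ0)) (Or.inr (by finiteness))
      rw [ENNReal.ofReal_zero, zero_mul] at h
      obtain ⟨R, h1, h2⟩ :=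
        ((ENNReal.tendsto_nhds_zero.1 h _ hε2).and (eventually_gt_atTop 0)).exists
      exact ⟨R, h2, h1⟩
    filter_upwards [ENNReal.tendsto_nhds_zero.1 (hball R) _ hε2] with ij hij
    rw [← lintegral_add_compl _ (measurableSet_ball (x := (0 : EuclideanSpace ℝ (Fin n)))
      (ε := R)), ← ENNReal.add_halves ε]
    gcongr
    refine (setLIntegral_compl_ball_norm_rpow_neg_mul_le (by fun_prop) hτ0.le hr2.le hrq
      hR).trans (le_trans ?_ hRε)
    gcongr
    exacts [hvK ij, hvK' ij]
  have hreal (ij : ℕ × ℕ) : ∫ x, ‖x‖ ^ (-τ) * ‖u (φ ij.1) x - u (φ ij.2) x‖ ^ r =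
      (∫⁻ x, ENNReal.ofReal (‖x‖ ^ (-τ)) * ‖v ij x‖ₑ ^ r).toReal := by
    rw [integral_eq_lintegral_of_nonneg_ae (.of_forall fun x => by positivity)
      (Measurable.aestronglyMeasurable ?_)]
    · congr 1
      refine lintegral_congr fun x => ?_
      rw [ENNReal.ofReal_mul (by positivity),
        ← ENNReal.ofReal_rpow_of_nonneg (norm_nonneg (_ - _)) (by linarith), ofReal_norm]
    · have := hvm ij
      exact (by fun_prop : Measurable fun x => ‖x‖ ^ (-τ) * ‖v ij x‖ ^ r)
  simp only [hreal]
  rw [← ENNReal.toReal_zero]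
  exact (ENNReal.tendsto_toReal ENNReal.zero_ne_top).comp hmain
end

section
/- (Gagliardo–Nirenberg type inequality with inverse-square potential, Theorem 1.3.) Let n ≥ 3, λ > −(n−2)²/4, 0 < α < n, 0 < τ < 1 + α/n, and p = 1 + (2 − 2τ + α)/(n − 2). Then there exists a constant C > 0 such that for every u ∈ C_c^∞(ℝⁿ, ℂ), ∫_{ℝⁿ}∫_{ℝⁿ} |x|^{−τ} |u(x)|^p |x − y|^{α−n} |y|^{−τ} |u(y)|^p dx dy ≤ C ( ∫_{ℝⁿ} |∇u|² dx + λ ∫_{ℝⁿ} |u(x)|²/|x|² dx )^p. -/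
open MeasureTheory
open scoped ENNReal NNReal

theorem two_mul_mul_inv_le {k ε : ℝ} (hk : 0 < k) (hε : 0 < ε) (r v a : ℝ) :
    2 * (v * (a * r)) * (r ^ 2 + ε)⁻¹ ≤ 2 / k * a ^ 2 + k / 2 * (v ^ 2 * (r ^ 2 + ε)⁻¹) := by
  have hpos : 0 < r ^ 2 + ε := by positivity
  have h3 : r ^ 2 * ((r ^ 2 + ε)⁻¹) ^ 2 ≤ (r ^ 2 + ε)⁻¹ := by
    field_simp
    linarith
  generalize (r ^ 2 + ε)⁻¹ = ψ at *
  have h5 : 0 ≤ 2 / k * (a - k / 2 * (v * r * ψ)) ^ 2 := by positivity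
  have h6 : 2 / k * a ^ 2 + k / 2 * (v ^ 2 * (r ^ 2 * ψ ^ 2)) - 2 * (v * (a * r)) * ψ =
      2 / k * (a - k / 2 * (v * r * ψ)) ^ 2 := by
    field_simp
    ring
  have h7 : k / 2 * (v ^ 2 * (r ^ 2 * ψ ^ 2)) ≤ k / 2 * (v ^ 2 * ψ) := by gcongr
  linarith

theorem abs_fderiv_norm_sq_apply_le {E F : Type*} [NormedAddCommGroup E] [NormedSpace ℝ E]
    [NormedAddCommGroup F] [InnerProductSpace ℝ F] {u : E → F} {x : E}
    (hu : DifferentiableAt ℝ u x) (v : E) :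
    |fderiv ℝ (fun x => ‖u x‖ ^ 2) x v| ≤ 2 * (‖u x‖ * (‖fderiv ℝ u x‖ * ‖v‖)) := by
  rw [hu.hasFDerivAt.norm_sq.fderiv, smul_apply, ContinuousLinearMap.comp_apply,
    innerSL_apply_apply, nsmul_eq_mul, abs_mul]
  push_cast
  rw [abs_two]
  gcongr
  exact (abs_real_inner_le_norm _ _).trans (by gcongr; exact (fderiv ℝ u x).le_opNorm v)

section Hardy

variable {E : Type*} [NormedAddCommGroup E] [InnerProductSpace ℝ E] [FiniteDimensional ℝ E]
  [MeasurableSpace E] [BorelSpace E] (μ : Measure E) [μ.IsAddHaarMeasure]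

/-- Integration by parts against the regularised field `x / (‖x‖² + ε)`. -/
theorem integral_mul_div_regularized_field {w : E → ℝ} (hw : ContDiff ℝ 1 w)
    (hwc : HasCompactSupport w) {ε : ℝ} (hε : 0 < ε) :
    ∫ x, w x * (Module.finrank ℝ E * (‖x‖ ^ 2 + ε)⁻¹ - 2 * ‖x‖ ^ 2 * ((‖x‖ ^ 2 + ε)⁻¹) ^ 2) ∂μ =
      - ∫ x, fderiv ℝ w x x * (‖x‖ ^ 2 + ε)⁻¹ ∂μ := by
  have hpos : ∀ x : E, ‖x‖ ^ 2 + ε ≠ 0 := fun x => by positivity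
  let b := stdOrthonormalBasis ℝ E
  let ψ : E → ℝ := fun x => (‖x‖ ^ 2 + ε)⁻¹
  have hψ : ContDiff ℝ 1 ψ := ((contDiff_norm_sq ℝ).add contDiff_const).inv hpos
  let g : Fin (Module.finrank ℝ E) → E → ℝ := fun i x => ψ x * inner ℝ (b i) x
  have hg : ∀ i, ContDiff ℝ 1 (g i) := fun i => hψ.mul (contDiff_const.inner ℝ contDiff_id)
  have hg' : ∀ i x, fderiv ℝ (g i) x (b i) = ψ x - 2 * inner ℝ (b i) x ^ 2 * ψ x ^ 2 := by
    intro i x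
    have h1 : HasFDerivAt ψ (-((‖x‖ ^ 2 + ε) ^ 2)⁻¹ • (2 • innerSL ℝ x)) x :=
      (hasDerivAt_inv (hpos x)).comp_hasFDerivAt x
        ((hasStrictFDerivAt_norm_sq x).hasFDerivAt.add_const ε)
    have h2 : HasFDerivAt (fun y => inner ℝ (b i) y) (innerSL ℝ (b i)) x :=
      (innerSL ℝ (b i)).hasFDerivAt
    have h3 := h1.mul h2
    rw [show g i = ψ * fun y => inner ℝ (b i) y from rfl, h3.fderiv]
    have : inner ℝ (b i) (b i) = (1 : ℝ) := by simp
    simp only [add_apply, smul_apply, innerSL_apply_apply,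
      smul_eq_mul, this, real_inner_comm (b i) x, nsmul_eq_mul, ψ]
    field_simp
    push_cast
    ring
  have hw' : Continuous (fderiv ℝ w) := hw.continuous_fderiv one_ne_zero
  have hwd : ∀ i, Integrable (fun x => fderiv ℝ w x (b i) * g i x) μ := fun i =>
    (((hw'.clm_apply continuous_const).mul (hg i).continuous).integrable_of_hasCompactSupport
      ((hwc.fderiv_apply ℝ (b i)).mul_right))
  have hgd : ∀ i, Integrable (fun x => w x * fderiv ℝ (g i) x (b i)) μ := fun i =>
    ((hw.continuous.mul (((hg i).continuous_fderiv one_ne_zero).clm_apply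
      continuous_const)).integrable_of_hasCompactSupport hwc.mul_right)
  have key : ∀ i, ∫ x, w x * fderiv ℝ (g i) x (b i) ∂μ =
      -∫ x, fderiv ℝ w x (b i) * g i x ∂μ := fun i =>
    integral_mul_fderiv_eq_neg_fderiv_mul_of_integrable (hwd i) (hgd i)
      ((hw.continuous.mul (hg i).continuous).integrable_of_hasCompactSupport hwc.mul_right)
      (fun x _ => hw.differentiable one_ne_zero x) (fun x _ => (hg i).differentiable one_ne_zero x)
  have hsum := Finset.sum_congr (rfl : Finset.univ = Finset.univ) (fun i _ => key i)
  rw [Finset.sum_neg_distrib, ← integral_finsetSum _ (fun i _ => hwd i),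
    ← integral_finsetSum _ (fun i _ => hgd i)] at hsum
  refine (integral_congr_ae (.of_forall fun x => ?_)).trans
    (hsum.trans (congrArg Neg.neg (integral_congr_ae (.of_forall fun x => ?_))))
  · rw [← Finset.mul_sum]
    simp only [hg', Finset.sum_sub_distrib, Finset.sum_const, Finset.card_univ, Fintype.card_fin,
      nsmul_eq_mul, ← Finset.sum_mul, ← Finset.mul_sum, b.sum_sq_inner_right, ψ]
  · have hx : fderiv ℝ w x x = ∑ i, inner ℝ (b i) x * fderiv ℝ w x (b i) := by
      conv_lhs => rw [← congrArg (fderiv ℝ w x) (b.sum_repr' x), map_sum]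
      simp only [map_smul, smul_eq_mul]
    symm
    dsimp only
    rw [hx, Finset.sum_mul]
    exact Finset.sum_congr rfl fun i _ => by simp only [g, ψ]; ring

/-- The sharp Hardy inequality for a regularised weight. -/
theorem integral_sq_mul_inv_le_integral_fderiv_sq (hd : 2 < Module.finrank ℝ E) {u : E → ℂ}
    (hu : ContDiff ℝ 1 u) (huc : HasCompactSupport u) {ε : ℝ} (hε : 0 < ε) :
    ∫ x, ‖u x‖ ^ 2 * (‖x‖ ^ 2 + ε)⁻¹ ∂μ ≤
      4 / ((Module.finrank ℝ E : ℝ) - 2) ^ 2 * ∫ x, ‖fderiv ℝ u x‖ ^ 2 ∂μ := by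
  set d : ℝ := (Module.finrank ℝ E : ℝ) with hd_def
  have hd2 : 0 < d - 2 := by
    have : (2 : ℝ) < d := by rw [hd_def]; exact_mod_cast hd
    linarith
  have hpos : ∀ x : E, 0 < ‖x‖ ^ 2 + ε := fun x => by positivity
  have hw : ContDiff ℝ 1 (fun x => ‖u x‖ ^ 2) := hu.norm_sq ℝ
  have hwc : HasCompactSupport (fun x => ‖u x‖ ^ 2) :=
    huc.comp_left (g := fun z : ℂ => ‖z‖ ^ 2) (by simp)
  have hψ : Continuous fun x : E => (‖x‖ ^ 2 + ε)⁻¹ :=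
    ((continuous_norm.pow 2).add continuous_const).inv₀ fun x => (hpos x).ne'
  have hu' : Continuous (fderiv ℝ u) := hu.continuous_fderiv one_ne_zero
  have hw' := hw.continuous_fderiv one_ne_zero
  have hint := integral_mul_div_regularized_field μ hw hwc hε
  have hI : Integrable (fun x => ‖u x‖ ^ 2 * (‖x‖ ^ 2 + ε)⁻¹) μ :=
    (hw.continuous.mul hψ).integrable_of_hasCompactSupport hwc.mul_right
  have hDc : HasCompactSupport fun x => ‖fderiv ℝ u x‖ ^ 2 :=
    (huc.fderiv ℝ).mono fun x hx h => hx (by simp [h])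
  have hD : Integrable (fun x => ‖fderiv ℝ u x‖ ^ 2) μ :=
    (hu'.norm.pow 2).integrable_of_hasCompactSupport hDc
  have hL : Integrable (fun x => ‖u x‖ ^ 2 *
      (d * (‖x‖ ^ 2 + ε)⁻¹ - 2 * ‖x‖ ^ 2 * ((‖x‖ ^ 2 + ε)⁻¹) ^ 2)) μ :=
    (hw.continuous.mul ((continuous_const.mul hψ).sub
      ((continuous_const.mul (continuous_norm.pow 2)).mul (hψ.pow
        2)))).integrable_of_hasCompactSupport
      hwc.mul_right
  have hR0 : Continuous fun x => fderiv ℝ (fun x => ‖u x‖ ^ 2) x x := hw'.clm_apply continuous_id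
  have hRc : HasCompactSupport fun x => fderiv ℝ (fun x => ‖u x‖ ^ 2) x x :=
    (hwc.fderiv ℝ).mono fun x hx h => hx (by dsimp only; rw [h, zero_apply])
  have hR : Integrable (fun x => fderiv ℝ (fun x => ‖u x‖ ^ 2) x x * (‖x‖ ^ 2 + ε)⁻¹) μ :=
    (hR0.mul hψ).integrable_of_hasCompactSupport hRc.mul_right
  have h1 : (d - 2) * ∫ x, ‖u x‖ ^ 2 * (‖x‖ ^ 2 + ε)⁻¹ ∂μ ≤ ∫ x, ‖u x‖ ^ 2 *
      (d * (‖x‖ ^ 2 + ε)⁻¹ - 2 * ‖x‖ ^ 2 * ((‖x‖ ^ 2 + ε)⁻¹) ^ 2) ∂μ := by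
    rw [← integral_const_mul]
    refine integral_mono (hI.const_mul _) hL fun x => ?_
    have := hpos x
    have h3 : ‖x‖ ^ 2 * ((‖x‖ ^ 2 + ε)⁻¹) ^ 2 ≤ (‖x‖ ^ 2 + ε)⁻¹ := by
      field_simp
      linarith
    have := mul_le_mul_of_nonneg_left h3 (sq_nonneg ‖u x‖)
    dsimp only
    linarith
  have h2 : -∫ x, fderiv ℝ (fun x => ‖u x‖ ^ 2) x x * (‖x‖ ^ 2 + ε)⁻¹ ∂μ ≤
      2 / (d - 2) * (∫ x, ‖fderiv ℝ u x‖ ^ 2 ∂μ) +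
        (d - 2) / 2 * ∫ x, ‖u x‖ ^ 2 * (‖x‖ ^ 2 + ε)⁻¹ ∂μ := by
    rw [← integral_neg, ← integral_const_mul, ← integral_const_mul,
      ← integral_add (hD.const_mul _) (hI.const_mul _)]
    refine integral_mono hR.neg ((hD.const_mul _).add (hI.const_mul _)) fun x => ?_
    have hder := abs_fderiv_norm_sq_apply_le (hu.differentiable one_ne_zero x) x
    have hψ0 : 0 ≤ (‖x‖ ^ 2 + ε)⁻¹ := (inv_pos.2 (hpos x)).le
    refine le_trans ?_ (two_mul_mul_inv_le hd2 hε ‖x‖ ‖u x‖ ‖fderiv ℝ u x‖)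
    dsimp only [Pi.neg_apply]
    rw [← neg_mul]
    exact mul_le_mul_of_nonneg_right ((neg_le_abs _).trans hder) hψ0
  have h3 : (d - 2) / 2 * ∫ x, ‖u x‖ ^ 2 * (‖x‖ ^ 2 + ε)⁻¹ ∂μ ≤
      2 / (d - 2) * ∫ x, ‖fderiv ℝ u x‖ ^ 2 ∂μ := by linarith
  calc ∫ x, ‖u x‖ ^ 2 * (‖x‖ ^ 2 + ε)⁻¹ ∂μ
      = 2 / (d - 2) * ((d - 2) / 2 * ∫ x, ‖u x‖ ^ 2 * (‖x‖ ^ 2 + ε)⁻¹ ∂μ) := by field_simp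
    _ ≤ 2 / (d - 2) * (2 / (d - 2) * ∫ x, ‖fderiv ℝ u x‖ ^ 2 ∂μ) := by gcongr
    _ = _ := by field_simp; ring

/-- The sharp Hardy inequality. -/
theorem lintegral_sq_div_norm_sq_le (hd : 2 < Module.finrank ℝ E) {u : E → ℂ}
    (hu : ContDiff ℝ 1 u) (huc : HasCompactSupport u) :
    ∫⁻ x, ENNReal.ofReal (‖u x‖ ^ 2 / ‖x‖ ^ 2) ∂μ ≤
      ENNReal.ofReal (4 / ((Module.finrank ℝ E : ℝ) - 2) ^ 2 * ∫ x, ‖fderiv ℝ u x‖ ^ 2 ∂μ) := by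
  have : Nontrivial E := Module.nontrivial_of_finrank_pos (R := ℝ) (by omega)
  let F : ℕ → E → ℝ≥0∞ := fun k x => ENNReal.ofReal (‖u x‖ ^ 2 * (‖x‖ ^ 2 + 1 / ((k : ℝ) + 1))⁻¹)
  have hpos : ∀ (k : ℕ) (x : E), ‖x‖ ^ 2 + 1 / ((k : ℝ) + 1) ≠ 0 := fun k x => by positivity
  have hc : ∀ k : ℕ, Continuous fun x : E => ‖u x‖ ^ 2 * (‖x‖ ^ 2 + 1 / ((k : ℝ) + 1))⁻¹ :=
    fun k => (hu.continuous.norm.pow 2).mul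
      (((continuous_norm.pow 2).add continuous_const).inv₀ (hpos k))
  have hlim : ∀ᵐ x ∂μ, ENNReal.ofReal (‖u x‖ ^ 2 / ‖x‖ ^ 2) =
      Filter.liminf (fun k => F k x) Filter.atTop := by
    filter_upwards [Measure.ae_ne μ (0 : E)] with x hx
    refine (Filter.Tendsto.liminf_eq ?_).symm
    refine (ENNReal.continuous_ofReal.tendsto _).comp ?_
    rw [div_eq_mul_inv]
    refine Filter.Tendsto.mul tendsto_const_nhds (Filter.Tendsto.inv₀ ?_ (by positivity))
    simpa using (tendsto_const_nhds (x := ‖x‖ ^ 2)).add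
      (tendsto_one_div_add_atTop_nhds_zero_nat (𝕜 := ℝ))
  rw [lintegral_congr_ae hlim]
  refine (lintegral_liminf_le fun k => (hc k).measurable.ennreal_ofReal).trans ?_
  refine Filter.liminf_le_of_le (by isBoundedDefault) fun b hb => ?_
  obtain ⟨k, hk⟩ := hb.exists
  refine hk.trans ?_
  rw [← ofReal_integral_eq_lintegral_ofReal]
  · exact ENNReal.ofReal_le_ofReal
      (integral_sq_mul_inv_le_integral_fderiv_sq μ hd hu huc (by positivity))
  · refine (hc k).integrable_of_hasCompactSupport (HasCompactSupport.mul_right ?_)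
    exact huc.comp_left (g := fun z : ℂ => ‖z‖ ^ 2) (by simp)
  · exact Filter.Eventually.of_forall fun x => by positivity

/-- The sharp Hardy inequality, for Bochner integrals. -/
theorem integral_sq_div_norm_sq_le (hd : 2 < Module.finrank ℝ E) {u : E → ℂ}
    (hu : ContDiff ℝ 1 u) (huc : HasCompactSupport u) :
    ∫ x, ‖u x‖ ^ 2 / ‖x‖ ^ 2 ∂μ ≤
      4 / ((Module.finrank ℝ E : ℝ) - 2) ^ 2 * ∫ x, ‖fderiv ℝ u x‖ ^ 2 ∂μ := by
  have hm : Measurable fun x : E => ‖u x‖ ^ 2 / ‖x‖ ^ 2 :=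
    (hu.continuous.norm.pow 2).measurable.div (continuous_norm.pow 2).measurable
  rw [integral_eq_lintegral_of_nonneg_ae (.of_forall fun x => by positivity)
    hm.aestronglyMeasurable]
  exact ENNReal.toReal_le_of_le_ofReal
    (mul_nonneg (by positivity) (integral_nonneg fun x => by positivity))
    (lintegral_sq_div_norm_sq_le μ hd hu huc)

/-- The Sobolev inequality in integral form. -/
theorem exists_lintegral_rpow_le_fderiv (hd : 2 < Module.finrank ℝ E) :
    ∃ C : ℝ≥0∞, C ≠ ∞ ∧ ∀ u : E → ℂ, ContDiff ℝ 1 u → HasCompactSupport u →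
      ∫⁻ x, ‖u x‖ₑ ^ (2 * (Module.finrank ℝ E : ℝ) / (Module.finrank ℝ E - 2)) ∂μ ≤
        C * ENNReal.ofReal (∫ x, ‖fderiv ℝ u x‖ ^ 2 ∂μ) ^
          ((Module.finrank ℝ E : ℝ) / (Module.finrank ℝ E - 2)) := by
  have hd2 : (2 : ℝ) < Module.finrank ℝ E := by exact_mod_cast hd
  set d : ℝ := (Module.finrank ℝ E : ℝ) with hd_def
  have hd3 : 0 < d - 2 := by linarith
  have hd4 : 0 < d := by linarith
  let q : ℝ≥0 := ⟨2 * d / (d - 2), by positivity⟩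
  have hq : (q : ℝ) = 2 * d / (d - 2) := rfl
  have hq0 : 0 < (q : ℝ) := by rw [hq]; positivity
  refine ⟨(SNormLESNormFDerivOfEqConst ℂ μ 2 : ℝ≥0∞) ^ (q : ℝ),
    ENNReal.rpow_ne_top_of_nonneg hq0.le ENNReal.coe_ne_top, fun u hu huc => ?_⟩
  have hp' : ((q : ℝ≥0) : ℝ)⁻¹ = ((2 : ℝ≥0) : ℝ)⁻¹ - (Module.finrank ℝ E : ℝ)⁻¹ := by
    rw [hq, ← hd_def]
    push_cast
    field_simp
  have h := eLpNorm_le_eLpNorm_fderiv_of_eq μ hu huc (p := 2) (p' := q) (by norm_num)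
    (by omega) hp'
  have hD : Integrable (fun x => ‖fderiv ℝ u x‖ ^ 2) μ :=
    ((hu.continuous_fderiv one_ne_zero).norm.pow 2).integrable_of_hasCompactSupport
      ((huc.fderiv ℝ).mono fun x hx h => hx (by simp [h]))
  have hG : ENNReal.ofReal (∫ x, ‖fderiv ℝ u x‖ ^ 2 ∂μ) = ∫⁻ x, ‖fderiv ℝ u x‖ₑ ^ (2 : ℝ) ∂μ := by
    rw [ofReal_integral_eq_lintegral_ofReal hD (.of_forall fun x => by positivity)]
    refine lintegral_congr fun x => ?_
    rw [ENNReal.ofReal_pow (norm_nonneg _), ofReal_norm, ENNReal.rpow_ofNat]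
  have hqe : (q : ℝ≥0∞) ≠ 0 := by simpa using (NNReal.coe_pos.1 hq0).ne'
  rw [eLpNorm_eq_lintegral_rpow_enorm_toReal hqe ENNReal.coe_ne_top,
    eLpNorm_eq_lintegral_rpow_enorm_toReal (by norm_num) ENNReal.coe_ne_top] at h
  simp only [ENNReal.coe_toReal, NNReal.coe_ofNat] at h
  rw [← hG] at h
  have h2 := ENNReal.rpow_le_rpow h hq0.le
  rw [← ENNReal.rpow_mul, ENNReal.mul_rpow_of_nonneg _ _ hq0.le, ← ENNReal.rpow_mul,
    one_div_mul_cancel hq0.ne', ENNReal.rpow_one] at h2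
  have e : d / (d - 2) = 1 / 2 * q := by
    rw [hq]
    field_simp
  rwa [e, ← hq]

/-- The Hardy–Sobolev inequality, interpolating between the Hardy and Sobolev inequalities. -/
theorem exists_lintegral_norm_rpow_mul_rpow_le (hd : 2 < Module.finrank ℝ E) {s : ℝ}
    (hs0 : 0 ≤ s) (hs2 : s ≤ 2) :
    ∃ C : ℝ≥0∞, C ≠ ∞ ∧ ∀ u : E → ℂ, ContDiff ℝ 1 u → HasCompactSupport u →
      ∫⁻ x, ENNReal.ofReal (‖x‖ ^ (-s) *
        ‖u x‖ ^ (2 * ((Module.finrank ℝ E : ℝ) - s) / (Module.finrank ℝ E - 2))) ∂μ ≤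
        C * ENNReal.ofReal (∫ x, ‖fderiv ℝ u x‖ ^ 2 ∂μ) ^
          (((Module.finrank ℝ E : ℝ) - s) / (Module.finrank ℝ E - 2)) := by
  have : Nontrivial E := Module.nontrivial_of_finrank_pos (R := ℝ) (by omega)
  obtain ⟨C, hC, hS⟩ := exists_lintegral_rpow_le_fderiv μ hd
  have hd2 : (2 : ℝ) < Module.finrank ℝ E := by exact_mod_cast hd
  have hH := fun u => lintegral_sq_div_norm_sq_le μ hd (u := u)
  set d : ℝ := (Module.finrank ℝ E : ℝ) with hd_def
  have hd3 : 0 < d - 2 := by linarith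
  have hd4 : 0 < d := by linarith
  have hs1 : 0 ≤ 1 - s / 2 := by linarith
  have hs3 : 0 ≤ s / 2 := by linarith
  refine ⟨ENNReal.ofReal (4 / (d - 2) ^ 2) ^ (s / 2) * C ^ (1 - s / 2), ENNReal.mul_ne_top
    (ENNReal.rpow_ne_top_of_nonneg hs3 ENNReal.ofReal_ne_top)
    (ENNReal.rpow_ne_top_of_nonneg hs1 hC), fun u hu huc => ?_⟩
  have hpt : ∀ᵐ x ∂μ, ENNReal.ofReal (‖x‖ ^ (-s) * ‖u x‖ ^ (2 * (d - s) / (d - 2))) =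
      ENNReal.ofReal (‖u x‖ ^ 2 / ‖x‖ ^ 2) ^ (s / 2) *
        (‖u x‖ₑ ^ (2 * d / (d - 2))) ^ (1 - s / 2) := by
    filter_upwards [Measure.ae_ne μ (0 : E)] with x hx
    have hx0 : 0 < ‖x‖ := norm_pos_iff.2 hx
    rw [← ofReal_norm, ENNReal.ofReal_rpow_of_nonneg (norm_nonneg _) (by positivity),
      ENNReal.ofReal_rpow_of_nonneg (by positivity) hs3,
      ENNReal.ofReal_rpow_of_nonneg (by positivity) hs1, ← ENNReal.ofReal_mul (by positivity)]
    congr 1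
    rw [Real.div_rpow (by positivity) (by positivity), ← Real.rpow_natCast, ← Real.rpow_natCast,
      ← Real.rpow_mul (by positivity), ← Real.rpow_mul (by positivity),
      ← Real.rpow_mul (by positivity), Real.rpow_neg hx0.le]
    have e1 : 2 * (d - s) / (d - 2) = s + 2 * d / (d - 2) * (1 - s / 2) := by
      field_simp
      ring
    have e2 : ((2 : ℕ) : ℝ) * (s / 2) = s := by push_cast; ring
    rw [e1, e2, Real.rpow_add_of_nonneg (norm_nonneg _) hs0 (by positivity)]
    ring
  rw [lintegral_congr_ae hpt]
  have hm1 : Measurable fun x => ENNReal.ofReal (‖u x‖ ^ 2 / ‖x‖ ^ 2) :=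
    ((hu.continuous.norm.pow 2).measurable.div (continuous_norm.pow 2).measurable).ennreal_ofReal
  have hm2 : Measurable fun x => ‖u x‖ₑ ^ (2 * d / (d - 2)) :=
    hu.continuous.measurable.enorm.pow_const _
  refine (ENNReal.lintegral_mul_norm_pow_le hm1.aemeasurable hm2.aemeasurable hs3 hs1
    (by ring)).trans ?_
  refine (mul_le_mul' (ENNReal.rpow_le_rpow (hH u hu huc) hs3)
    (ENNReal.rpow_le_rpow (hS u hu huc) hs1)).trans_eq ?_
  rw [ENNReal.ofReal_mul (by positivity), ENNReal.mul_rpow_of_nonneg _ _ hs3,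
    ENNReal.mul_rpow_of_nonneg _ _ hs1, ← ENNReal.rpow_mul]
  have e : (d - s) / (d - 2) = s / 2 + d / (d - 2) * (1 - s / 2) := by
    field_simp
    ring
  rw [e, ENNReal.rpow_add_of_nonneg _ _ hs3 (by positivity)]
  ring

end Hardy

section Riesz

theorem norm_sub_rpow_mul_norm_rpow_le {E : Type*} [NormedAddCommGroup E] {m c : ℝ} (hm : 0 < m)
    (hc : 0 < c) {e y : E} (he : ‖e‖ = 1) (h1 : 1 / 2 < ‖e - y‖) (h2 : 1 / 2 < ‖y‖) :
    ‖e - y‖ ^ (-m) * ‖y‖ ^ (-c) ≤ 5 ^ m * 3 ^ c * (1 + ‖y‖) ^ (-(m + c)) := by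
  have h3 : ‖y‖ ≤ ‖e - y‖ + 1 := by
    have := norm_sub_norm_le y e
    rw [norm_sub_rev, he] at this
    linarith
  have hA : ‖e - y‖ ^ (-m) ≤ 5 ^ m * (1 + ‖y‖) ^ (-m) := by
    rw [Real.rpow_neg (norm_nonneg _), Real.rpow_neg (by positivity),
      ← Real.inv_rpow (by positivity), ← Real.inv_rpow (by positivity),
      ← Real.mul_rpow (by positivity) (by positivity)]
    refine Real.rpow_le_rpow (by positivity) ?_ hm.le
    rw [← div_eq_mul_inv, inv_eq_one_div, div_le_div_iff₀ (by linarith) (by positivity)]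
    linarith
  have hB : ‖y‖ ^ (-c) ≤ 3 ^ c * (1 + ‖y‖) ^ (-c) := by
    rw [Real.rpow_neg (norm_nonneg _), Real.rpow_neg (by positivity),
      ← Real.inv_rpow (by positivity), ← Real.inv_rpow (by positivity),
      ← Real.mul_rpow (by positivity) (by positivity)]
    refine Real.rpow_le_rpow (by positivity) ?_ hc.le
    rw [← div_eq_mul_inv, inv_eq_one_div, div_le_div_iff₀ (by linarith) (by positivity)]
    linarith
  calc _ ≤ (5 ^ m * (1 + ‖y‖) ^ (-m)) * (3 ^ c * (1 + ‖y‖) ^ (-c)) := by gcongr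
    _ = _ := by rw [neg_add, Real.rpow_add (by positivity)]; ring

/-- Factorization of the Stein–Weiss integrand for a three-term Hölder inequality. -/
theorem mul_rpow_mul_eq_rpow_mul_rpow_mul_rpow {d α q m c a : ℝ} (hq1 : 1 < q) (hq2 : q ≤ 2)
    (hm : m = q * (d - α) / (2 * (q - 1))) (hc : c = d - m / 2)
    (ha : a = q * (d + α) / 2 - d) {X Y t A B : ℝ} (hX : 0 < X) (hY : 0 < Y) (ht : 0 < t)
    (hA : 0 ≤ A) (hB : 0 ≤ B) :
    A * t ^ (α - d) * B =
      (X ^ a * A ^ q * (Y ^ a * B ^ q)) ^ (2 / q - 1) *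
        (X ^ a * A ^ q * (X ^ (m + c - d) * t ^ (-m) * Y ^ (-c))) ^ (1 - 1 / q) *
        (Y ^ a * B ^ q * (Y ^ (m + c - d) * t ^ (-m) * X ^ (-c))) ^ (1 - 1 / q) := by
  have hq0 : 0 < q := by linarith
  have hq3 : q - 1 ≠ 0 := by linarith
  have e1 : ∀ {Z : ℝ}, 0 < Z → Z ^ (a * (2 / q - 1)) * Z ^ (a * (1 - 1 / q)) *
      Z ^ ((m + c - d) * (1 - 1 / q)) * Z ^ (-c * (1 - 1 / q)) = 1 := fun {Z} hZ => by
    rw [← Real.rpow_add hZ, ← Real.rpow_add hZ, ← Real.rpow_add hZ]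
    convert Real.rpow_zero Z using 2
    rw [ha, hc, hm]
    field_simp
    ring
  have e2 : ∀ {Z : ℝ}, 0 ≤ Z → Z ^ (q * (2 / q - 1)) * Z ^ (q * (1 - 1 / q)) = Z :=
    fun {Z} hZ => by
    have h1 : q * (2 / q - 1) = 2 - q := by field_simp
    have h2 : q * (1 - 1 / q) = q - 1 := by field_simp
    rw [h1, h2, ← Real.rpow_add_of_nonneg hZ (by linarith) (by linarith)]
    convert Real.rpow_one Z using 2
    ring
  have e3 : t ^ (-m * (1 - 1 / q)) * t ^ (-m * (1 - 1 / q)) = t ^ (α - d) := by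
    rw [← Real.rpow_add ht]
    congr 1
    rw [hm]
    field_simp
    ring
  have hXp : ∀ r : ℝ, 0 ≤ X ^ r := fun r => Real.rpow_nonneg hX.le r
  have hYp : ∀ r : ℝ, 0 ≤ Y ^ r := fun r => Real.rpow_nonneg hY.le r
  have htp : ∀ r : ℝ, 0 ≤ t ^ r := fun r => Real.rpow_nonneg ht.le r
  have hAp : ∀ r : ℝ, 0 ≤ A ^ r := fun r => Real.rpow_nonneg hA r
  have hBp : ∀ r : ℝ, 0 ≤ B ^ r := fun r => Real.rpow_nonneg hB r
  have expand1 : (X ^ a * A ^ q * (Y ^ a * B ^ q)) ^ (2 / q - 1) =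
      X ^ (a * (2 / q - 1)) * A ^ (q * (2 / q - 1)) *
        (Y ^ (a * (2 / q - 1)) * B ^ (q * (2 / q - 1))) := by
    rw [Real.mul_rpow (mul_nonneg (hXp _) (hAp _)) (mul_nonneg (hYp _) (hBp _)),
      Real.mul_rpow (hXp _) (hAp _), Real.mul_rpow (hYp _) (hBp _), Real.rpow_mul hX.le,
      Real.rpow_mul hA, Real.rpow_mul hY.le, Real.rpow_mul hB]
  have expand2 : ∀ {X Y A : ℝ}, 0 < X → 0 < Y → 0 ≤ A →
      (X ^ a * A ^ q * (X ^ (m + c - d) * t ^ (-m) * Y ^ (-c))) ^ (1 - 1 / q) =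
      X ^ (a * (1 - 1 / q)) * A ^ (q * (1 - 1 / q)) * (X ^ ((m + c - d) * (1 - 1 / q)) *
        t ^ (-m * (1 - 1 / q)) * Y ^ (-c * (1 - 1 / q))) := fun {X Y A} hX hY hA => by
    rw [Real.mul_rpow (by positivity) (by positivity), Real.mul_rpow (by positivity)
      (by positivity), Real.mul_rpow (by positivity) (by positivity),
      Real.mul_rpow (by positivity) (by positivity), Real.rpow_mul hX.le, Real.rpow_mul hA,
      Real.rpow_mul hX.le, Real.rpow_mul hY.le, Real.rpow_mul ht.le]
  rw [expand1, expand2 hX hY hA, expand2 hY hX hB]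
  calc A * t ^ (α - d) * B
      = (A ^ (q * (2 / q - 1)) * A ^ (q * (1 - 1 / q))) *
        (t ^ (-m * (1 - 1 / q)) * t ^ (-m * (1 - 1 / q))) *
        (B ^ (q * (2 / q - 1)) * B ^ (q * (1 - 1 / q))) *
        (X ^ (a * (2 / q - 1)) * X ^ (a * (1 - 1 / q)) *
          X ^ ((m + c - d) * (1 - 1 / q)) * X ^ (-c * (1 - 1 / q))) *
        (Y ^ (a * (2 / q - 1)) * Y ^ (a * (1 - 1 / q)) *
          Y ^ ((m + c - d) * (1 - 1 / q)) * Y ^ (-c * (1 - 1 / q))) := by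
        rw [e1 hX, e1 hY, e2 hA, e2 hB, e3, mul_one, mul_one]
    _ = _ := by ring

variable {E : Type*} [NormedAddCommGroup E] [NormedSpace ℝ E] [FiniteDimensional ℝ E]
  [MeasurableSpace E] [BorelSpace E] (μ : Measure E) [μ.IsAddHaarMeasure]

theorem lintegral_indicator_ball_norm_rpow_lt_top [Nontrivial E] {c : ℝ}
    (hc : c < Module.finrank ℝ E) :
    ∫⁻ y, (Metric.ball (0 : E) 1).indicator (fun y => ENNReal.ofReal (‖y‖ ^ (-c))) y ∂μ < ∞ := by
  rw [lintegral_indicator Metric.isOpen_ball.measurableSet]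
  have hm : Measurable fun y : E => ‖y‖ ^ (-c) := measurable_norm.pow_const _
  have h : IntegrableOn (fun y : E => ‖y‖ ^ (-c)) (Metric.ball 0 1) μ :=
    integrableOn_ball_of_norm_le_rpow Module.finrank_pos hc (C := 1)
      (.of_forall fun y => by rw [Real.norm_of_nonneg (by positivity), one_mul])
      hm.aestronglyMeasurable
  exact h.lintegral_lt_top

theorem lintegral_one_add_norm_rpow_lt_top {b : ℝ} (hb : Module.finrank ℝ E < b) :
    ∫⁻ y : E, ENNReal.ofReal ((1 + ‖y‖) ^ (-b)) ∂μ < ∞ :=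
  (integrable_one_add_norm hb).lintegral_lt_top

/-- Uniform bound over the unit sphere for the Riesz-type integrals
`∫ ‖e - y‖ ^ (-m) * ‖y‖ ^ (-c)`. -/
theorem exists_lintegral_norm_sub_rpow_mul_norm_rpow_le_of_norm_eq_one [Nontrivial E] {m c : ℝ}
    (hm : 0 < m) (hmd : m < Module.finrank ℝ E) (hc : 0 < c) (hcd : c < Module.finrank ℝ E)
    (hmc : Module.finrank ℝ E < m + c) :
    ∃ M : ℝ≥0∞, M ≠ ∞ ∧ ∀ e : E, ‖e‖ = 1 →
      ∫⁻ y, ENNReal.ofReal (‖e - y‖ ^ (-m) * ‖y‖ ^ (-c)) ∂μ ≤ M := by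
  let φ : ℝ → E → ℝ≥0∞ := fun a =>
    (Metric.ball (0 : E) 1).indicator (fun y => ENNReal.ofReal (‖y‖ ^ (-a)))
  have hφ : ∀ a, Measurable (φ a) := fun a =>
    (measurable_norm.pow_const _).ennreal_ofReal.indicator Metric.isOpen_ball.measurableSet
  let χ : E → ℝ≥0∞ := fun y => ENNReal.ofReal ((1 + ‖y‖) ^ (-(m + c)))
  have hχ : Measurable χ := by fun_prop
  refine ⟨ENNReal.ofReal (2 ^ m) * (∫⁻ y, φ c y ∂μ) + ENNReal.ofReal (2 ^ c) * (∫⁻ y, φ m y ∂μ) +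
    ENNReal.ofReal (5 ^ m * 3 ^ c) * ∫⁻ y, χ y ∂μ, ?_, fun e he => ?_⟩
  · have h1 := (lintegral_indicator_ball_norm_rpow_lt_top μ hcd).ne
    have h2 := (lintegral_indicator_ball_norm_rpow_lt_top μ hmd).ne
    have h3 := (lintegral_one_add_norm_rpow_lt_top μ hmc).ne
    simp only [φ, χ]
    finiteness
  · have hpt : ∀ y, ENNReal.ofReal (‖e - y‖ ^ (-m) * ‖y‖ ^ (-c)) ≤
        ENNReal.ofReal (2 ^ m) * φ c y + ENNReal.ofReal (2 ^ c) * φ m (e - y) +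
          ENNReal.ofReal (5 ^ m * 3 ^ c) * χ y := by
      intro y
      have half : ∀ {t a : ℝ}, 1 / 2 ≤ t → 0 < a → t ^ (-a) ≤ 2 ^ a := fun {t a} ht ha => by
        rw [Real.rpow_neg (by linarith), ← Real.inv_rpow (by linarith)]
        exact Real.rpow_le_rpow (inv_nonneg.2 (by linarith))
          (by rw [inv_le_comm₀ (by linarith) two_pos]; linarith) ha.le
      by_cases h2 : ‖y‖ ≤ 1 / 2
      · have hy : φ c y = ENNReal.ofReal (‖y‖ ^ (-c)) :=
          Set.indicator_of_mem (by rw [mem_ball_zero_iff]; linarith) _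
        refine le_trans ?_ (le_trans le_self_add le_self_add)
        rw [hy, ← ENNReal.ofReal_mul (by positivity)]
        have := norm_sub_norm_le e y
        gcongr
        exact half (by linarith) hm
      by_cases h1 : ‖e - y‖ ≤ 1 / 2
      · have hy : φ m (e - y) = ENNReal.ofReal (‖e - y‖ ^ (-m)) :=
          Set.indicator_of_mem (by rw [mem_ball_zero_iff]; linarith) _
        refine le_trans ?_ (le_trans le_add_self le_self_add)
        rw [hy, ← ENNReal.ofReal_mul (by positivity), mul_comm]
        gcongr
        exact half (by linarith) hc
      · refine le_trans ?_ le_add_self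
        rw [← ENNReal.ofReal_mul (by positivity)]
        exact ENNReal.ofReal_le_ofReal
          (norm_sub_rpow_mul_norm_rpow_le hm hc he (not_le.1 h1) (not_le.1 h2))
    have hφe : Measurable fun y => φ m (e - y) :=
      (hφ m).comp (measurable_const.sub measurable_id)
    refine (lintegral_mono hpt).trans_eq ?_
    rw [lintegral_add_right _ (hχ.const_mul _), lintegral_add_left ((hφ c).const_mul _),
      lintegral_const_mul _ (hφ c), lintegral_const_mul _ hχ,
      lintegral_const_mul _ hφe,
      lintegral_sub_left_eq_self (φ m) e]

/-- The Riesz-type composition estimate for power weights. -/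
theorem exists_lintegral_norm_sub_rpow_mul_norm_rpow_le [Nontrivial E] {m c : ℝ}
    (hm : 0 < m) (hmd : m < Module.finrank ℝ E) (hc : 0 < c) (hcd : c < Module.finrank ℝ E)
    (hmc : Module.finrank ℝ E < m + c) :
    ∃ M : ℝ≥0∞, M ≠ ∞ ∧ ∀ x : E, x ≠ 0 →
      ∫⁻ y, ENNReal.ofReal (‖x‖ ^ (m + c - Module.finrank ℝ E) * ‖x - y‖ ^ (-m) * ‖y‖ ^ (-c)) ∂μ
        ≤ M := by
  obtain ⟨M, hM, h⟩ :=
    exists_lintegral_norm_sub_rpow_mul_norm_rpow_le_of_norm_eq_one μ hm hmd hc hcd hmc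
  refine ⟨M, hM, fun x hx => ?_⟩
  have hx0 : 0 < ‖x‖ := norm_pos_iff.2 hx
  set R := ‖x‖ with hR
  let g : E → ℝ≥0∞ := fun y => ENNReal.ofReal
    (‖x‖ ^ (m + c - Module.finrank ℝ E) * ‖x - y‖ ^ (-m) * ‖y‖ ^ (-c))
  have hg : Measurable g := by fun_prop
  have hmap : ∫⁻ y, g (R • y) ∂μ =
      ENNReal.ofReal (|(R ^ Module.finrank ℝ E)⁻¹|) * ∫⁻ y, g y ∂μ := by
    rw [← lintegral_map hg (measurable_const_smul R), Measure.map_addHaar_smul μ hx0.ne',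
      lintegral_smul_measure, smul_eq_mul]
  have hscale : ∀ y, g (R • y) = ENNReal.ofReal (|(R ^ Module.finrank ℝ E)⁻¹|) *
      ENNReal.ofReal (‖R⁻¹ • x - y‖ ^ (-m) * ‖y‖ ^ (-c)) := by
    intro y
    have e1 : ‖x - R • y‖ = R * ‖R⁻¹ • x - y‖ := by
      rw [← abs_of_pos hx0, ← Real.norm_eq_abs, ← norm_smul, Real.norm_eq_abs, abs_of_pos hx0,
        smul_sub, smul_inv_smul₀ hx0.ne']
    have e2 : ‖R • y‖ = R * ‖y‖ := by rw [norm_smul, Real.norm_eq_abs, abs_of_pos hx0]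
    rw [← ENNReal.ofReal_mul (abs_nonneg _)]
    simp only [g]
    rw [e1, e2, Real.mul_rpow hx0.le (norm_nonneg _), Real.mul_rpow hx0.le (norm_nonneg _),
      abs_of_pos (by positivity), ← Real.rpow_natCast, ← Real.rpow_neg hx0.le]
    congr 1
    have e3 : R ^ (-(Module.finrank ℝ E : ℝ)) =
        R ^ (m + c - Module.finrank ℝ E) * R ^ (-m) * R ^ (-c) := by
      rw [← Real.rpow_add hx0, ← Real.rpow_add hx0]
      congr 1
      ring
    rw [e3]
    ring
  have hc0 : ENNReal.ofReal (|(R ^ Module.finrank ℝ E)⁻¹|) ≠ 0 := by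
    simp only [ne_eq, ENNReal.ofReal_eq_zero, not_le]
    positivity
  simp only [hscale] at hmap
  rw [lintegral_const_mul _ (by fun_prop),
    ENNReal.mul_right_inj hc0 ENNReal.ofReal_ne_top] at hmap
  change ∫⁻ y, g y ∂μ ≤ M
  rw [← hmap]
  exact h _ (norm_smul_inv_norm (𝕜 := ℝ) hx)

/-- A diagonal Stein–Weiss inequality with strictly positive power weight `‖x‖ ^ a` on the
right-hand side, where `a` is fixed by scaling. -/
theorem exists_lintegral_lintegral_mul_norm_sub_rpow_mul_le [Nontrivial E] {α q : ℝ}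
    (hα : α < Module.finrank ℝ E) (hq1 : 1 < q) (hq2 : q ≤ 2)
    (hq : 2 * Module.finrank ℝ E < q * (Module.finrank ℝ E + α)) :
    ∃ M : ℝ≥0∞, M ≠ ∞ ∧ ∀ f : E → ℝ, Measurable f → (∀ x, 0 ≤ f x) →
      ∫⁻ x, ∫⁻ y, ENNReal.ofReal (f x * ‖x - y‖ ^ (α - Module.finrank ℝ E) * f y) ∂μ ∂μ ≤
        M * (∫⁻ x, ENNReal.ofReal
          (‖x‖ ^ (q * (Module.finrank ℝ E + α) / 2 - Module.finrank ℝ E) * f x ^ q) ∂μ) ^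
            (2 / q) := by
  have hker := fun m c => exists_lintegral_norm_sub_rpow_mul_norm_rpow_le μ (m := m) (c := c)
  set d : ℝ := (Module.finrank ℝ E : ℝ) with hd
  set a : ℝ := q * (d + α) / 2 - d with ha
  have hq3 : 0 < q - 1 := by linarith
  have hq0 : 0 < q := by linarith
  obtain ⟨m, hm⟩ : ∃ m, m = q * (d - α) / (2 * (q - 1)) := ⟨_, rfl⟩
  obtain ⟨c, hc⟩ : ∃ c, c = d - m / 2 := ⟨_, rfl⟩
  have hm0 : 0 < m := by
    rw [hm]
    exact div_pos (mul_pos hq0 (by linarith)) (by linarith)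
  have hmd : m < d := by
    rw [hm, div_lt_iff₀ (by linarith)]
    linarith
  obtain ⟨M, hM, hMx⟩ := hker m c hm0 hmd (by linarith) (by linarith) (by linarith)
  have hθ1 : 0 ≤ 2 / q - 1 := by
    rw [sub_nonneg, le_div_iff₀ hq0]
    linarith
  have hθ2 : 0 ≤ 1 - 1 / q := by
    rw [sub_nonneg, div_le_iff₀ hq0]
    linarith
  refine ⟨M ^ (1 - 1 / q) * M ^ (1 - 1 / q), ENNReal.mul_ne_top
    (ENNReal.rpow_ne_top_of_nonneg hθ2 hM) (ENNReal.rpow_ne_top_of_nonneg hθ2 hM),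
    fun f hf hf0 => ?_⟩
  let F : E → ℝ≥0∞ := fun x => ENNReal.ofReal (‖x‖ ^ a * f x ^ q)
  let k : E → E → ℝ≥0∞ := fun x y =>
    ENNReal.ofReal (‖x‖ ^ (m + c - d) * ‖x - y‖ ^ (-m) * ‖y‖ ^ (-c))
  have hF : Measurable F := by fun_prop
  have hk : Measurable (Function.uncurry k) := by
    simp only [k, Function.uncurry_def]
    fun_prop
  have hk' : ∀ x, Measurable (k x) := fun x => hk.of_uncurry_left
  set I : ℝ≥0∞ := ∫⁻ x, F x ∂μ with hI
  let G : Fin 3 → E × E → ℝ≥0∞ := ![fun z => F z.1 * F z.2, fun z => F z.1 * k z.1 z.2,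
    fun z => F z.2 * k z.2 z.1]
  let θ : Fin 3 → ℝ := ![2 / q - 1, 1 - 1 / q, 1 - 1 / q]
  have hG0 : Measurable (G 0) := (hF.comp measurable_fst).mul (hF.comp measurable_snd)
  have hG1 : Measurable (G 1) := (hF.comp measurable_fst).mul hk
  have hG2 : Measurable (G 2) := (hF.comp measurable_snd).mul (hk.comp measurable_swap)
  have hG : ∀ i, Measurable (G i) := by
    intro i
    fin_cases i
    exacts [hG0, hG1, hG2]
  have hpt : ∫⁻ x, ∫⁻ y, ENNReal.ofReal (f x * ‖x - y‖ ^ (α - d) * f y) ∂μ ∂μ =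
      ∫⁻ x, ∫⁻ y, ∏ i, G i (x, y) ^ θ i ∂μ ∂μ := by
    refine lintegral_congr_ae ?_
    filter_upwards [Measure.ae_ne μ (0 : E)] with x hx
    refine lintegral_congr_ae ?_
    filter_upwards [Measure.ae_ne μ (0 : E), Measure.ae_ne μ x] with y hy hyx
    have hfx := hf0 x
    have hfy := hf0 y
    rw [mul_rpow_mul_eq_rpow_mul_rpow_mul_rpow hq1 hq2 hm hc ha (norm_pos_iff.2 hx)
      (norm_pos_iff.2 hy) (norm_pos_iff.2 (sub_ne_zero.2 hyx.symm)) hfx hfy,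
      ENNReal.ofReal_mul (by positivity), ENNReal.ofReal_mul (by positivity),
      ← ENNReal.ofReal_rpow_of_nonneg (by positivity) hθ1,
      ← ENNReal.ofReal_rpow_of_nonneg (by positivity) hθ2,
      ← ENNReal.ofReal_rpow_of_nonneg (by positivity) hθ2,
      ENNReal.ofReal_mul (by positivity), ENNReal.ofReal_mul (q := _ * _) (by positivity),
      ENNReal.ofReal_mul (p := ‖y‖ ^ a * f y ^ q) (by positivity), Fin.prod_univ_three]
    simp only [G, θ, F, k, Matrix.cons_val, norm_sub_rev y x]
  rw [hpt, ← lintegral_prod (fun z => ∏ i, G i z ^ θ i) (by fun_prop)]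
  refine (ENNReal.lintegral_prod_norm_pow_le Finset.univ (fun i _ => (hG i).aemeasurable)
    (by simp only [θ, Fin.sum_univ_three, Matrix.cons_val]; ring) fun i _ => by
      fin_cases i
      exacts [hθ1, hθ2, hθ2]).trans ?_
  have hI0 : ∫⁻ z, G 0 z ∂μ.prod μ = I * I :=
    lintegral_prod_mul hF.aemeasurable hF.aemeasurable
  have hbound : ∫⁻ x, ∫⁻ y, F x * k x y ∂μ ∂μ ≤ I * M := by
    rw [hI, ← lintegral_mul_const _ hF]
    refine lintegral_mono_ae ?_
    filter_upwards [Measure.ae_ne μ (0 : E)] with x hx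
    rw [lintegral_const_mul _ (hk' x)]
    gcongr
    exact hMx x hx
  have hI1 : ∫⁻ z, G 1 z ∂μ.prod μ ≤ I * M := by
    rw [lintegral_prod _ hG1.aemeasurable]
    exact hbound
  have hI2 : ∫⁻ z, G 2 z ∂μ.prod μ ≤ I * M := by
    rw [lintegral_prod_symm _ hG2.aemeasurable]
    exact hbound
  rw [Fin.prod_univ_three, hI0]
  simp only [θ, Matrix.cons_val]
  calc (I * I) ^ (2 / q - 1) * (∫⁻ z, G 1 z ∂μ.prod μ) ^ (1 - 1 / q) *
        (∫⁻ z, G 2 z ∂μ.prod μ) ^ (1 - 1 / q)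
      ≤ (I * I) ^ (2 / q - 1) * (I * M) ^ (1 - 1 / q) * (I * M) ^ (1 - 1 / q) := by
        gcongr
    _ = M ^ (1 - 1 / q) * M ^ (1 - 1 / q) * I ^ (2 / q) := by
        have e : 2 / q = (2 / q - 1) + (2 / q - 1) + (1 - 1 / q) + (1 - 1 / q) := by ring
        rw [ENNReal.mul_rpow_of_nonneg _ _ hθ1, ENNReal.mul_rpow_of_nonneg _ _ hθ2]
        conv_rhs => rw [e, ENNReal.rpow_add_of_nonneg _ _ (by positivity) hθ2,
          ENNReal.rpow_add_of_nonneg _ _ (by positivity) hθ2,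
          ENNReal.rpow_add_of_nonneg _ _ hθ1 hθ1]
        ring

end Riesz

section Choquard

/-- The exponents interpolating between the Stein–Weiss and Hardy–Sobolev inequalities. -/
theorem exists_steinWeiss_hardySobolev_exponents {d α τ : ℝ} (hd : 3 ≤ d) (hα0 : 0 < α)
    (hαd : α < d) (hτ0 : 0 < τ) (hτ : τ < 1 + α / d) :
    ∃ s q : ℝ, 0 ≤ s ∧ s ≤ 2 ∧ 1 < q ∧ q ≤ 2 ∧ 2 * d < q * (d + α) ∧
      q * (d + α - 2 * τ) = 2 * (d - s) ∧ 0 < d + α - 2 * τ := by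
  have hτ' : τ * d < d + α := by
    have := mul_lt_mul_of_pos_right hτ (by linarith : 0 < d)
    rwa [add_mul, one_mul, div_mul_cancel₀ _ (by linarith)] at this
  have h2 : 2 * τ < d + α := by nlinarith
  rcases le_total (2 * τ) α with h | h
  · refine ⟨0, 2 * d / (d + α - 2 * τ), le_rfl, zero_le_two, ?_, ?_, ?_, ?_, by linarith⟩
    · rw [lt_div_iff₀ (by linarith)]
      linarith
    · rw [div_le_iff₀ (by linarith)]
      linarith
    · rw [div_mul_eq_mul_div, lt_div_iff₀ (by linarith)]
      nlinarith
    · rw [sub_zero, div_mul_cancel₀ _ (by linarith)]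
  · refine ⟨2 * τ - α, 2, by linarith, ?_, one_lt_two, le_rfl, by linarith, by ring, by linarith⟩
    nlinarith

/-- An iterated Bochner integral of a nonnegative kernel is bounded by the iterated lower Lebesgue
integral. -/
theorem integral_integral_le_of_lintegral_lintegral_le {X Y : Type*} [MeasurableSpace X]
    [MeasurableSpace Y] {μ : Measure X} {ν : Measure Y} {k : X → Y → ℝ} (hk : ∀ x y, 0 ≤ k x y)
    {b : ℝ} (hb : 0 ≤ b) (h : ∫⁻ x, ∫⁻ y, ENNReal.ofReal (k x y) ∂ν ∂μ ≤ ENNReal.ofReal b) :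
    ∫ x, ∫ y, k x y ∂ν ∂μ ≤ b := by
  by_cases hm : AEStronglyMeasurable (fun x => ∫ y, k x y ∂ν) μ
  · rw [integral_eq_lintegral_of_nonneg_ae
      (.of_forall fun x => integral_nonneg fun y => hk x y) hm]
    refine ENNReal.toReal_le_of_le_ofReal hb ((lintegral_mono fun x => ?_).trans h)
    by_cases hx : Integrable (k x) ν
    · exact (ofReal_integral_eq_lintegral_ofReal hx (.of_forall (hk x))).le
    · simp [integral_undef hx]
  · rwa [integral_undef fun hi => hm hi.aestronglyMeasurable]

variable {E : Type*} [NormedAddCommGroup E] [InnerProductSpace ℝ E] [FiniteDimensional ℝ E]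
  [MeasurableSpace E] [BorelSpace E] (μ : Measure E) [μ.IsAddHaarMeasure]

/-- A bound of the nonlocal energy with critical exponent by the Dirichlet energy. -/
theorem exists_lintegral_lintegral_energy_le {α τ : ℝ}
    (hd : 2 < Module.finrank ℝ E) (hα0 : 0 < α) (hαd : α < Module.finrank ℝ E) (hτ0 : 0 < τ)
    (hτ : τ < 1 + α / Module.finrank ℝ E) :
    ∃ C : ℝ≥0∞, C ≠ ∞ ∧ ∀ u : E → ℂ, ContDiff ℝ 1 u → HasCompactSupport u →
      ∫⁻ x, ∫⁻ y, ENNReal.ofReal (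
        ‖x‖ ^ (-τ) * ‖u x‖ ^ (((Module.finrank ℝ E : ℝ) + α - 2 * τ) / (Module.finrank ℝ E - 2)) *
        ‖x - y‖ ^ (α - Module.finrank ℝ E) *
        (‖y‖ ^ (-τ) *
          ‖u y‖ ^ (((Module.finrank ℝ E : ℝ) + α - 2 * τ) / (Module.finrank ℝ E - 2)))) ∂μ ∂μ ≤
        C * ENNReal.ofReal (∫ x, ‖fderiv ℝ u x‖ ^ 2 ∂μ) ^
          (((Module.finrank ℝ E : ℝ) + α - 2 * τ) / (Module.finrank ℝ E - 2)) := by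
  have : Nontrivial E := Module.nontrivial_of_finrank_pos (R := ℝ) (by omega)
  have hd3 : (3 : ℝ) ≤ Module.finrank ℝ E := by exact_mod_cast hd
  obtain ⟨s, q, hs0, hs2, hq1, hq2, hq, hsq, hp⟩ :=
    exists_steinWeiss_hardySobolev_exponents hd3 hα0 hαd hτ0 hτ
  obtain ⟨M, hM, hSW⟩ := exists_lintegral_lintegral_mul_norm_sub_rpow_mul_le μ hαd hq1 hq2 hq
  obtain ⟨K, hK, hHS⟩ := exists_lintegral_norm_rpow_mul_rpow_le μ hd hs0 hs2
  set d : ℝ := (Module.finrank ℝ E : ℝ)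
  have hq0 : 0 < q := by linarith
  have hd2 : 0 < d - 2 := by linarith
  have e1 : (d + α - 2 * τ) / (d - 2) * q = 2 * (d - s) / (d - 2) := by
    rw [← hsq]
    ring
  have e2 : -τ * q + (q * (d + α) / 2 - d) = -s := by linarith
  have e3 : (d - s) / (d - 2) * (2 / q) = (d + α - 2 * τ) / (d - 2) := by
    field_simp
    linarith
  refine ⟨M * K ^ (2 / q), ENNReal.mul_ne_top hM
    (ENNReal.rpow_ne_top_of_nonneg (by positivity) hK), fun u hu huc => ?_⟩
  have hum : Measurable u := hu.continuous.measurable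
  refine (hSW (fun x => ‖x‖ ^ (-τ) * ‖u x‖ ^ ((d + α - 2 * τ) / (d - 2))) (by fun_prop)
    (fun x => by positivity)).trans ?_
  rw [mul_assoc, ← e3, ENNReal.rpow_mul, ← ENNReal.mul_rpow_of_nonneg _ _ (by positivity), e3]
  gcongr
  refine (lintegral_mono_ae ?_).trans (hHS u hu huc)
  filter_upwards [Measure.ae_ne μ (0 : E)] with x hx
  refine ENNReal.ofReal_le_ofReal (le_of_eq ?_)
  have hx0 : 0 < ‖x‖ := norm_pos_iff.2 hx
  rw [Real.mul_rpow (by positivity) (by positivity), ← Real.rpow_mul hx0.le,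
    ← Real.rpow_mul (norm_nonneg _), e1, ← mul_assoc, ← Real.rpow_add hx0, add_comm, e2]

/-- The quadratic form of `-Δ + lam / ‖x‖ ^ 2` with subcritical `lam` controls the Dirichlet
energy. -/
theorem exists_integral_norm_fderiv_sq_le (hd : 2 < Module.finrank ℝ E) {lam : ℝ}
    (hlam : -(((Module.finrank ℝ E : ℝ) - 2) ^ 2 / 4) < lam) :
    ∃ C : ℝ, 0 < C ∧ ∀ u : E → ℂ, ContDiff ℝ 1 u → HasCompactSupport u →
      ∫ x, ‖fderiv ℝ u x‖ ^ 2 ∂μ ≤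
        C * ((∫ x, ‖fderiv ℝ u x‖ ^ 2 ∂μ) + lam * ∫ x, ‖u x‖ ^ 2 / ‖x‖ ^ 2 ∂μ) := by
  have hH := fun u => integral_sq_div_norm_sq_le μ hd (u := u)
  have hd2 : (2 : ℝ) < Module.finrank ℝ E := by exact_mod_cast hd
  set d : ℝ := (Module.finrank ℝ E : ℝ)
  have hB0 : ∀ u : E → ℂ, 0 ≤ ∫ x, ‖u x‖ ^ 2 / ‖x‖ ^ 2 ∂μ :=
    fun u => integral_nonneg fun x => by positivity
  rcases le_or_gt 0 lam with h0 | h0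
  · refine ⟨1, one_pos, fun u hu huc => ?_⟩
    have := mul_nonneg h0 (hB0 u)
    linarith
  · have hpos : 0 < (d - 2) ^ 2 / 4 := by
      have : 0 < d - 2 := by linarith
      positivity
    have hc : 0 < 1 + lam * (4 / (d - 2) ^ 2) := by
      have h1 : -lam * (4 / (d - 2) ^ 2) < (d - 2) ^ 2 / 4 * (4 / (d - 2) ^ 2) :=
        mul_lt_mul_of_pos_right (by linarith) (by
          have : 0 < d - 2 := by linarith
          positivity)
      have h2 : (d - 2) ^ 2 / 4 * (4 / (d - 2) ^ 2) = 1 := by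
        have : 0 < d - 2 := by linarith
        field_simp
      linarith
    refine ⟨(1 + lam * (4 / (d - 2) ^ 2))⁻¹, inv_pos.2 hc, fun u hu huc => ?_⟩
    rw [inv_mul_eq_div, le_div_iff₀ hc]
    have := mul_le_mul_of_nonpos_left (hH u hu huc) h0.le
    linarith

end Choquard

/-- Gagliardo–Nirenberg type inequality with inverse-square potential (Theorem 1.3):
`P[u] ≤ C (‖∇u‖² + λ‖u/|x|‖²)^p` for the energy-critical exponent `p`. -/
theorem gagliardo_nirenberg_inverse_square (n : ℕ) (hn : 3 ≤ n) (lam α τ p : ℝ)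
    (hlam : -(((n : ℝ) - 2) ^ 2 / 4) < lam) (hα0 : 0 < α) (hαn : α < n)
    (hτ0 : 0 < τ) (hτ : τ < 1 + α / n) (hp : p = 1 + (2 - 2 * τ + α) / ((n : ℝ) - 2)) :
    ∃ C : ℝ, 0 < C ∧ ∀ u : EuclideanSpace ℝ (Fin n) → ℂ,
      ContDiff ℝ (⊤ : ℕ∞) u → HasCompactSupport u →
      (∫ x, ∫ y, ‖x‖ ^ (-τ) * ‖u x‖ ^ p * ‖x - y‖ ^ (α - (n : ℝ)) * ‖y‖ ^ (-τ) * ‖u y‖ ^ p)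
        ≤ C * ((∫ x, ‖fderiv ℝ u x‖ ^ 2) + lam * ∫ x, ‖u x‖ ^ 2 / ‖x‖ ^ 2) ^ p := by
  have hfin : Module.finrank ℝ (EuclideanSpace ℝ (Fin n)) = n := finrank_euclideanSpace_fin
  have hn3 : (3 : ℝ) ≤ n := by exact_mod_cast hn
  have hp' : p = ((n : ℝ) + α - 2 * τ) / (n - 2) := by
    have : (n : ℝ) - 2 ≠ 0 := by linarith
    rw [hp]
    field_simp
    ring
  have hp0 : 0 < p := by
    obtain ⟨_, _, -, -, -, -, -, -, h⟩ :=
      exists_steinWeiss_hardySobolev_exponents hn3 hα0 hαn hτ0 hτ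
    rw [hp']
    exact div_pos h (by linarith)
  obtain ⟨C₀, hC₀, h₀⟩ := exists_lintegral_lintegral_energy_le
    (volume : Measure (EuclideanSpace ℝ (Fin n))) (by omega) hα0 (by rwa [hfin]) hτ0
    (by rwa [hfin])
  obtain ⟨C₁, hC₁, h₁⟩ := exists_integral_norm_fderiv_sq_le
    (volume : Measure (EuclideanSpace ℝ (Fin n))) (by omega) (lam := lam) (by rwa [hfin])
  rw [hfin, ← hp'] at h₀
  refine ⟨C₀.toReal * C₁ ^ p + 1, by positivity, fun u hu huc => ?_⟩
  have hu1 : ContDiff ℝ 1 u := hu.of_le (by exact_mod_cast le_top)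
  have hDQ := h₁ u hu1 huc
  have hE := h₀ u hu1 huc
  set D := ∫ x, ‖fderiv ℝ u x‖ ^ 2
  set Q := D + lam * ∫ x, ‖u x‖ ^ 2 / ‖x‖ ^ 2
  have hD0 : 0 ≤ D := integral_nonneg fun x => by positivity
  have hQ0 : 0 ≤ Q := nonneg_of_mul_nonneg_right (hD0.trans hDQ) hC₁
  calc _ ≤ C₀.toReal * D ^ p := by
        refine integral_integral_le_of_lintegral_lintegral_le (fun x y => by positivity)
          (by positivity) ?_
        rw [ENNReal.ofReal_mul ENNReal.toReal_nonneg, ENNReal.ofReal_toReal hC₀,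
          ← ENNReal.ofReal_rpow_of_nonneg hD0 hp0.le]
        simpa only [mul_assoc] using hE
    _ ≤ C₀.toReal * (C₁ * Q) ^ p := by gcongr
    _ = C₀.toReal * C₁ ^ p * Q ^ p := by rw [Real.mul_rpow hC₁.le hQ0, mul_assoc]
    _ ≤ _ := by
        gcongr
        linarith
end
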